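/- arXiv:1603.08487 — 4 statements merged into one kernel-verified Lean document; each statement's English description precedes it below -/
import Mathlib

section
/- Every element of the d-modular framed Coxeter group of type B_n, W_{d,n}, can be expressed in standard form, that is, as a product m_1 m_2 ⋯ m_n where m_i ∈ 𝙽_{d,i} for each 1 ≤ i ≤ n. -/
set_option maxHeartbeats 1000000
set_option synthInstance.maxHeartbeats 400000

noncomputable section

/-- Generators of the `d`-modular framed Coxeter group of type `B_n`:
`r` is the generator `r₁`, `s i` is the generator `s_{i+1}` (`i : Fin (n-1)`),
and `t j` is the framing generator `t_{j+1}` (`j : Fin n`). -/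
inductive WGen (n : ℕ) : Type
  | r : WGen n
  | s : Fin (n - 1) → WGen n
  | t : Fin n → WGen n

/-- The generator `r₁` in the free group. -/
def Fr (n : ℕ) : FreeGroup (WGen n) := FreeGroup.of WGen.r

/-- The generator `s_i` (for `1 ≤ i ≤ n-1`) in the free group; junk value `1` out of range. -/
def Fs (n i : ℕ) : FreeGroup (WGen n) :=
  if h : 1 ≤ i ∧ i ≤ n - 1 then FreeGroup.of (WGen.s ⟨i - 1, by omega⟩) else 1

/-- The generator `t_j` (for `1 ≤ j ≤ n`) in the free group; junk value `1` out of range. -/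
def Ft (n j : ℕ) : FreeGroup (WGen n) :=
  if h : 1 ≤ j ∧ j ≤ n then FreeGroup.of (WGen.t ⟨j - 1, by omega⟩) else 1

/-- The action of the simple transposition `s_i` on indices: swaps `i` and `i+1`. -/
def sAct (i j : ℕ) : ℕ := if j = i then i + 1 else if j = i + 1 then i else j

/-- The defining relators of the `d`-modular framed Coxeter group of type `B_n`:
a relation `a = b` is recorded as the relator `a * b⁻¹`. -/
inductive Wrel (d n : ℕ) : FreeGroup (WGen n) → Prop
  | ss : ∀ i j : ℕ, 1 ≤ i → i ≤ n - 1 → 1 ≤ j → j ≤ n - 1 → (i + 1 < j ∨ j + 1 < i) →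
      Wrel d n (Fs n i * Fs n j * (Fs n j * Fs n i)⁻¹)
  | braid : ∀ i : ℕ, 1 ≤ i → i ≤ n - 2 →
      Wrel d n (Fs n i * Fs n (i + 1) * Fs n i * (Fs n (i + 1) * Fs n i * Fs n (i + 1))⁻¹)
  | rs : ∀ i : ℕ, 2 ≤ i → i ≤ n - 1 → Wrel d n (Fr n * Fs n i * (Fs n i * Fr n)⁻¹)
  | rsrs : Wrel d n (Fr n * Fs n 1 * Fr n * Fs n 1 * (Fs n 1 * Fr n * Fs n 1 * Fr n)⁻¹)
  | ssq : ∀ i : ℕ, 1 ≤ i → i ≤ n - 1 → Wrel d n (Fs n i ^ 2)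
  | rsq : Wrel d n (Fr n ^ 2)
  | tt : ∀ i j : ℕ, 1 ≤ i → i ≤ n → 1 ≤ j → j ≤ n →
      Wrel d n (Ft n i * Ft n j * (Ft n j * Ft n i)⁻¹)
  | td : ∀ j : ℕ, 1 ≤ j → j ≤ n → Wrel d n (Ft n j ^ d)
  | tr : ∀ j : ℕ, 1 ≤ j → j ≤ n → Wrel d n (Ft n j * Fr n * (Fr n * Ft n j)⁻¹)
  | ts : ∀ i j : ℕ, 1 ≤ i → i ≤ n - 1 → 1 ≤ j → j ≤ n →
      Wrel d n (Ft n j * Fs n i * (Fs n i * Ft n (sAct i j))⁻¹)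

/-- The `d`-modular framed Coxeter group of type `B_n`, `W_{d,n}`. -/
abbrev Wdn (d n : ℕ) : Type := PresentedGroup (setOf (Wrel d n))

/-- The canonical projection of the free group onto `W_{d,n}`. -/
def mkW (d n : ℕ) : FreeGroup (WGen n) →* Wdn d n := PresentedGroup.mk (setOf (Wrel d n))

/-- The generator `r₁` of `W_{d,n}`. -/
def rW (d n : ℕ) : Wdn d n := mkW d n (Fr n)

/-- The generator `s_i` of `W_{d,n}`. -/
def sW (d n i : ℕ) : Wdn d n := mkW d n (Fs n i)

/-- The generator `t_j` of `W_{d,n}`. -/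
def tW (d n j : ℕ) : Wdn d n := mkW d n (Ft n j)

/-- The elements `r_k = s_{k-1} ⋯ s_1 r_1 s_1 ⋯ s_{k-1}`, defined by
`r_k = s_{k-1} r_{k-1} s_{k-1}`, with `r_1` the generator `r₁`. -/
def rk (d n : ℕ) : ℕ → Wdn d n
  | 0 => 1
  | 1 => rW d n
  | (k + 2) => sW d n (k + 1) * rk d n (k + 1) * sW d n (k + 1)

/-- The subsets `𝙽_{d,k}` of `W_{d,n}`: `𝙽_{d,1} = {t₁^m, r₁ t₁^m : 0 ≤ m ≤ d-1}` and
`𝙽_{d,k} = {t_k^m, r_k t_k^m, s_{k-1} x : x ∈ 𝙽_{d,k-1}, 0 ≤ m ≤ d-1}`. -/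
def NW (d n : ℕ) : ℕ → Set (Wdn d n)
  | 0 => {1}
  | 1 => {x | ∃ m ≤ d - 1, x = tW d n 1 ^ m ∨ x = rk d n 1 * tW d n 1 ^ m}
  | (k + 2) => {x |
      (∃ m ≤ d - 1, x = tW d n (k + 2) ^ m ∨ x = rk d n (k + 2) * tW d n (k + 2) ^ m) ∨
      ∃ y ∈ NW d n (k + 1), x = sW d n (k + 1) * y}

section Relations

variable {d n : ℕ}

theorem mkW_eq_one_of_rel {x : FreeGroup (WGen n)} (h : Wrel d n x) : mkW d n x = 1 :=
  PresentedGroup.one_of_mem h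

theorem mkW_eq_of_rel {x y : FreeGroup (WGen n)} (h : Wrel d n (x * y⁻¹)) :
    mkW d n x = mkW d n y := by
  have := mkW_eq_one_of_rel h
  rwa [map_mul, map_inv, mul_inv_eq_one] at this

theorem rW_mul_self : rW d n * rW d n = 1 := by
  have := mkW_eq_one_of_rel (Wrel.rsq (d := d) (n := n))
  rwa [map_pow, pow_two] at this

theorem sW_mul_self {i : ℕ} (h1 : 1 ≤ i) (h2 : i < n) : sW d n i * sW d n i = 1 := by
  have := mkW_eq_one_of_rel (Wrel.ssq (d := d) (n := n) i h1 (by omega))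
  rwa [map_pow, pow_two] at this

theorem tW_pow {j : ℕ} (h1 : 1 ≤ j) (h2 : j ≤ n) : tW d n j ^ d = 1 := by
  have := mkW_eq_one_of_rel (Wrel.td (d := d) (n := n) j h1 h2)
  rwa [map_pow] at this

theorem sW_commute {i j : ℕ} (h1 : 1 ≤ i) (h2 : i + 1 < j) (h3 : j < n) :
    Commute (sW d n j) (sW d n i) := by
  have := mkW_eq_of_rel
    (Wrel.ss (d := d) (n := n) j i (by omega) (by omega) h1 (by omega) (by omega))
  simp only [map_mul] at this
  exact this

theorem sW_braid {i : ℕ} (h1 : 1 ≤ i) (h2 : i + 1 < n) :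
    sW d n i * sW d n (i + 1) * sW d n i = sW d n (i + 1) * sW d n i * sW d n (i + 1) := by
  have := mkW_eq_of_rel (Wrel.braid (d := d) (n := n) i h1 (by omega))
  simp only [map_mul] at this
  exact this

theorem rW_commute_sW {i : ℕ} (h1 : 2 ≤ i) (h2 : i < n) : Commute (rW d n) (sW d n i) := by
  have := mkW_eq_of_rel (Wrel.rs (d := d) (n := n) i h1 (by omega))
  simp only [map_mul] at this
  exact this

theorem rW_sW_braid : rW d n * sW d n 1 * rW d n * sW d n 1 =
    sW d n 1 * rW d n * sW d n 1 * rW d n := by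
  have := mkW_eq_of_rel (Wrel.rsrs (d := d) (n := n))
  simp only [map_mul] at this
  exact this

theorem tW_commute {i j : ℕ} (h1 : 1 ≤ i) (h2 : i ≤ n) (h3 : 1 ≤ j) (h4 : j ≤ n) :
    Commute (tW d n i) (tW d n j) := by
  have := mkW_eq_of_rel (Wrel.tt (d := d) (n := n) i j h1 h2 h3 h4)
  simp only [map_mul] at this
  exact this

theorem tW_commute_rW {j : ℕ} (h1 : 1 ≤ j) (h2 : j ≤ n) : Commute (tW d n j) (rW d n) := by
  have := mkW_eq_of_rel (Wrel.tr (d := d) (n := n) j h1 h2)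
  simp only [map_mul] at this
  exact this

theorem tW_mul_sW {i j : ℕ} (h1 : 1 ≤ i) (h2 : i < n) (h3 : 1 ≤ j) (h4 : j ≤ n) :
    tW d n j * sW d n i = sW d n i * tW d n (sAct i j) := by
  have := mkW_eq_of_rel (Wrel.ts (d := d) (n := n) i j h1 (by omega) h3 h4)
  simp only [map_mul] at this
  exact this

theorem tW_commute_sW {i j : ℕ} (h1 : 1 ≤ i) (h2 : i < n) (h3 : 1 ≤ j) (h4 : j ≤ n)
    (h5 : j ≠ i) (h6 : j ≠ i + 1) : Commute (tW d n j) (sW d n i) := by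
  have := tW_mul_sW (d := d) h1 h2 h3 h4
  rwa [sAct, if_neg h5, if_neg h6] at this

theorem tW_mul_sW_self {i : ℕ} (h1 : 1 ≤ i) (h2 : i < n) :
    SemiconjBy (sW d n i) (tW d n (i + 1)) (tW d n i) := by
  have := tW_mul_sW (d := d) h1 h2 h1 h2.le
  rw [sAct, if_pos rfl] at this
  exact this.symm

theorem tW_succ_mul_sW {i : ℕ} (h1 : 1 ≤ i) (h2 : i < n) :
    SemiconjBy (sW d n i) (tW d n i) (tW d n (i + 1)) := by
  have := tW_mul_sW (d := d) (j := i + 1) h1 h2 (by omega) (by omega)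
  rw [sAct, if_neg (by omega), if_pos rfl] at this
  exact this.symm

end Relations

/-- The generators `r₁`, `s_i` (`i < k`), `t_j` (`j ≤ k`) involving only the first `k` strands. -/
def strandGens (d n k : ℕ) : Set (Wdn d n) :=
  {x | (1 ≤ k ∧ x = rW d n) ∨ (∃ i, 1 ≤ i ∧ i < k ∧ x = sW d n i) ∨
    ∃ j, 1 ≤ j ∧ j ≤ k ∧ x = tW d n j}

/-- The submonoid of `W_{d,n}` generated by the generators on the first `k` strands. -/
def strandMonoid (d n k : ℕ) : Submonoid (Wdn d n) := Submonoid.closure (strandGens d n k)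

section StrandMonoid

variable {d n k : ℕ}

theorem strandGens_subset : strandGens d n k ⊆ strandMonoid d n k := Submonoid.subset_closure

theorem strandGens_mono {l : ℕ} (h : k ≤ l) : strandGens d n k ⊆ strandGens d n l := by
  rintro x (⟨h1, rfl⟩ | ⟨i, h1, h2, rfl⟩ | ⟨j, h1, h2, rfl⟩)
  · exact Or.inl ⟨by omega, rfl⟩
  · exact Or.inr (Or.inl ⟨i, h1, by omega, rfl⟩)
  · exact Or.inr (Or.inr ⟨j, h1, by omega, rfl⟩)

theorem strandMonoid_mono {l : ℕ} (h : k ≤ l) : strandMonoid d n k ≤ strandMonoid d n l :=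
  Submonoid.closure_mono (strandGens_mono h)

theorem rW_mem_strandMonoid (h : 1 ≤ k) : rW d n ∈ strandMonoid d n k :=
  strandGens_subset (Or.inl ⟨h, rfl⟩)

theorem sW_mem_strandMonoid {i : ℕ} (h1 : 1 ≤ i) (h2 : i < k) : sW d n i ∈ strandMonoid d n k :=
  strandGens_subset (Or.inr (Or.inl ⟨i, h1, h2, rfl⟩))

theorem tW_mem_strandMonoid {j : ℕ} (h1 : 1 ≤ j) (h2 : j ≤ k) : tW d n j ∈ strandMonoid d n k :=
  strandGens_subset (Or.inr (Or.inr ⟨j, h1, h2, rfl⟩))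

theorem commute_of_forall_strandGens {a : Wdn d n} (h : ∀ g ∈ strandGens d n k, Commute a g)
    {x : Wdn d n} (hx : x ∈ strandMonoid d n k) : Commute a x := by
  induction hx using Submonoid.closure_induction with
  | mem x hx => exact h x hx
  | one => exact Commute.one_right a
  | mul x y _ _ hx hy => exact hx.mul_right hy

theorem tW_succ_commute (hk : k < n) {x : Wdn d n} (hx : x ∈ strandMonoid d n k) :
    Commute (tW d n (k + 1)) x := by
  refine commute_of_forall_strandGens ?_ hx
  rintro g (⟨h1, rfl⟩ | ⟨i, h1, h2, rfl⟩ | ⟨j, h1, h2, rfl⟩)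
  · exact tW_commute_rW (by omega) (by omega)
  · exact tW_commute_sW h1 (by omega) (by omega) (by omega) (by omega) (by omega)
  · exact tW_commute (by omega) (by omega) h1 (by omega)

theorem sW_succ_commute (hk : k + 1 < n) {x : Wdn d n} (hx : x ∈ strandMonoid d n k) :
    Commute (sW d n (k + 1)) x := by
  refine commute_of_forall_strandGens ?_ hx
  rintro g (⟨h1, rfl⟩ | ⟨i, h1, h2, rfl⟩ | ⟨j, h1, h2, rfl⟩)
  · exact (rW_commute_sW (by omega) hk).symm
  · exact sW_commute h1 (by omega) hk
  · exact (tW_commute_sW (by omega) hk h1 (by omega) (by omega) (by omega)).symm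

theorem rk_mem_strandMonoid : ∀ k, rk d n (k + 1) ∈ strandMonoid d n (k + 1)
  | 0 => rW_mem_strandMonoid le_rfl
  | k + 1 => by
    have hs : sW d n (k + 1) ∈ strandMonoid d n (k + 2) :=
      sW_mem_strandMonoid (by omega) (by omega)
    exact mul_mem (mul_mem hs (strandMonoid_mono (by omega) (rk_mem_strandMonoid k))) hs

theorem rk_succ_semiconj (hk : k + 1 < n) :
    SemiconjBy (sW d n (k + 1)) (rk d n (k + 1)) (rk d n (k + 2)) := by
  change _ = sW d n (k + 1) * rk d n (k + 1) * sW d n (k + 1) * _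
  rw [mul_assoc _ (sW d n (k + 1)) (sW d n (k + 1)), sW_mul_self (by omega) hk, mul_one]

theorem rk_succ_commute (hk : k < n) {x : Wdn d n} (hx : x ∈ strandMonoid d n k) :
    Commute (rk d n (k + 1)) x := by
  induction k generalizing x with
  | zero =>
    refine commute_of_forall_strandGens ?_ hx
    rintro g (⟨h1, rfl⟩ | ⟨i, h1, h2, rfl⟩ | ⟨j, h1, h2, rfl⟩) <;> omega
  | succ k ih =>
    have key : ∀ y ∈ strandMonoid d n k, Commute (rk d n (k + 2)) y := fun y hy =>
      ((sW_succ_commute hk hy).mul_left (ih (by omega) hy)).mul_left (sW_succ_commute hk hy)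
    refine commute_of_forall_strandGens ?_ hx
    rintro g (⟨h1, rfl⟩ | ⟨i, h1, h2, rfl⟩ | ⟨j, h1, h2, rfl⟩)
    · rcases k with _ | k
      · change sW d n 1 * rW d n * sW d n 1 * rW d n = rW d n * (sW d n 1 * rW d n * sW d n 1)
        rw [← rW_sW_braid]
        simp only [mul_assoc]
      · exact key _ (rW_mem_strandMonoid (by omega))
    · rcases Nat.lt_or_ge i k with hi | hi
      · exact key _ (sW_mem_strandMonoid h1 hi)
      · obtain rfl : i = k := by omega
        obtain ⟨i, rfl⟩ : ∃ l, i = l + 1 := ⟨i - 1, by omega⟩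
        have hb := sW_braid (d := d) h1 hk
        have hc := sW_succ_commute hk (rk_mem_strandMonoid (d := d) (n := n) i)
        change sW d n (i + 1 + 1) * (sW d n (i + 1) * rk d n (i + 1) * sW d n (i + 1)) *
            sW d n (i + 1 + 1) * sW d n (i + 1) =
          sW d n (i + 1) * (sW d n (i + 1 + 1) * (sW d n (i + 1) * rk d n (i + 1) *
            sW d n (i + 1)) * sW d n (i + 1 + 1))
        generalize sW d n (i + 1 + 1) = a at *
        generalize sW d n (i + 1) = b at *
        generalize rk d n (i + 1) = c at *
        calc a * (b * c * b) * a * b = a * b * c * (b * a * b) := by simp only [mul_assoc]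
          _ = a * b * (c * a) * b * a := by rw [hb]; simp only [mul_assoc]
          _ = (a * b * a) * c * b * a := by rw [← hc.eq]; simp only [mul_assoc]
          _ = b * (a * (b * c * b) * a) := by rw [← hb]; simp only [mul_assoc]
    · rcases Nat.lt_or_ge k j with hj | hj
      · obtain rfl : j = k + 1 := by omega
        have ht : SemiconjBy (rk d n (k + 1)) (tW d n (k + 2)) (tW d n (k + 2)) :=
          (tW_succ_commute hk (rk_mem_strandMonoid k)).symm
        exact ((tW_mul_sW_self h1 hk).mul_left ht).mul_left (tW_succ_mul_sW h1 hk)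
      · exact key _ (tW_mem_strandMonoid h1 hj)

theorem NW_subset_strandMonoid : ∀ k, NW d n (k + 1) ⊆ strandMonoid d n (k + 1) := by
  intro k
  have ht : ∀ k, tW d n (k + 1) ∈ strandMonoid d n (k + 1) := fun k =>
    tW_mem_strandMonoid (by omega) le_rfl
  induction k with
  | zero =>
    rintro x ⟨m, -, rfl | rfl⟩
    · exact pow_mem (ht 0) m
    · exact mul_mem (rk_mem_strandMonoid 0) (pow_mem (ht 0) m)
  | succ k ih =>
    rintro x (⟨m, -, rfl | rfl⟩ | ⟨y, hy, rfl⟩)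
    · exact pow_mem (ht _) m
    · exact mul_mem (rk_mem_strandMonoid _) (pow_mem (ht _) m)
    · exact mul_mem (sW_mem_strandMonoid (by omega) (by omega))
        (strandMonoid_mono (by omega) (ih hy))

theorem tW_pow_mem_NW (hd : 1 ≤ d) (hk : k < n) (m : ℕ) :
    tW d n (k + 1) ^ m ∈ NW d n (k + 1) ∧
      rk d n (k + 1) * tW d n (k + 1) ^ m ∈ NW d n (k + 1) := by
  have hm : tW d n (k + 1) ^ m = tW d n (k + 1) ^ (m % d) :=
    pow_eq_pow_mod m (tW_pow (by omega) (by omega))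
  have hlt : m % d ≤ d - 1 := by have := Nat.mod_lt m hd; omega
  rw [hm]
  rcases k with _ | k
  · exact ⟨⟨_, hlt, Or.inl rfl⟩, ⟨_, hlt, Or.inr rfl⟩⟩
  · exact ⟨Or.inl ⟨_, hlt, Or.inl rfl⟩, Or.inl ⟨_, hlt, Or.inr rfl⟩⟩

theorem one_mem_NW (hd : 1 ≤ d) (hk : k < n) : 1 ∈ NW d n (k + 1) := by
  simpa using (tW_pow_mem_NW hd hk 0).1

theorem NW_mul_strandGens (hd : 1 ≤ d) (hk : k < n) {x g : Wdn d n} (hx : x ∈ NW d n (k + 1))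
    (hg : g ∈ strandGens d n (k + 1)) :
    ∃ u ∈ strandMonoid d n k, ∃ y ∈ NW d n (k + 1), x * g = u * y := by
  induction k generalizing x g with
  | zero =>
    refine ⟨1, one_mem _, x * g, ?_, (one_mul _).symm⟩
    obtain ⟨m, -, hx⟩ := hx
    have hr : Commute (tW d n 1 ^ m) (rW d n) := (tW_commute_rW le_rfl hk).pow_left m
    rcases hg with ⟨h1, rfl⟩ | ⟨i, h1, h2, rfl⟩ | ⟨j, h1, h2, rfl⟩
    · rcases hx with rfl | rfl
      · rw [hr.eq]
        exact (tW_pow_mem_NW hd hk m).2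
      · change rW d n * _ * _ ∈ _
        rw [mul_assoc, hr.eq, ← mul_assoc, rW_mul_self, one_mul]
        exact (tW_pow_mem_NW hd hk m).1
    · omega
    · obtain rfl : j = 1 := by omega
      rcases hx with rfl | rfl
      · rw [← pow_succ]
        exact (tW_pow_mem_NW hd hk (m + 1)).1
      · rw [mul_assoc, ← pow_succ]
        exact (tW_pow_mem_NW hd hk (m + 1)).2
  | succ k ih =>
    have hcases : g ∈ strandGens d n (k + 1) ∨ g = sW d n (k + 1) ∨ g = tW d n (k + 2) := by
      rcases hg with ⟨h1, rfl⟩ | ⟨i, h1, h2, rfl⟩ | ⟨j, h1, h2, rfl⟩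
      · exact Or.inl (Or.inl ⟨by omega, rfl⟩)
      · rcases Nat.lt_or_ge i (k + 1) with hi | hi
        · exact Or.inl (Or.inr (Or.inl ⟨i, h1, hi, rfl⟩))
        · exact Or.inr (Or.inl (by rw [show i = k + 1 by omega]))
      · rcases Nat.lt_or_ge (k + 1) j with hj | hj
        · exact Or.inr (Or.inr (by rw [show j = k + 2 by omega]))
        · exact Or.inl (Or.inr (Or.inr ⟨j, h1, hj, rfl⟩))
    rcases hx with ⟨m, -, hx⟩ | ⟨y, hy, rfl⟩
    · rcases hcases with hg | rfl | rfl
      · have hg' := strandGens_subset hg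
        have ht : Commute (tW d n (k + 2) ^ m) g := (tW_succ_commute hk hg').pow_left m
        refine ⟨g, hg', x, ?_⟩
        rcases hx with rfl | rfl
        · exact ⟨(tW_pow_mem_NW hd hk m).1, ht⟩
        · exact ⟨(tW_pow_mem_NW hd hk m).2, (rk_succ_commute hk hg').mul_left ht⟩
      · have ht : SemiconjBy (sW d n (k + 1)) (tW d n (k + 1) ^ m) (tW d n (k + 2) ^ m) :=
          (tW_succ_mul_sW (by omega) hk).pow_right m
        refine ⟨1, one_mem _, x * sW d n (k + 1), Or.inr ?_, (one_mul _).symm⟩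
        rcases hx with rfl | rfl
        · exact ⟨_, (tW_pow_mem_NW hd (by omega) m).1, ht.eq.symm⟩
        · exact ⟨_, (tW_pow_mem_NW hd (by omega) m).2,
            ((rk_succ_semiconj hk).mul_right ht).eq.symm⟩
      · refine ⟨1, one_mem _, x * tW d n (k + 2), ?_, (one_mul _).symm⟩
        rcases hx with rfl | rfl
        · rw [← pow_succ]
          exact (tW_pow_mem_NW hd hk (m + 1)).1
        · rw [mul_assoc, ← pow_succ]
          exact (tW_pow_mem_NW hd hk (m + 1)).2
    · rcases hcases with hg | rfl | rfl
      · obtain ⟨u, hu, z, hz, h⟩ := ih (by omega) hy hg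
        refine ⟨u, strandMonoid_mono (by omega) hu, sW d n (k + 1) * z, Or.inr ⟨z, hz, rfl⟩, ?_⟩
        rw [mul_assoc, h, ← mul_assoc, (sW_succ_commute hk hu).eq, mul_assoc]
      · have hs := sW_mul_self (d := d) (by omega) hk
        have base : ∀ m, ∃ u ∈ strandMonoid d n (k + 1), ∃ z ∈ NW d n (k + 2),
            sW d n (k + 1) * tW d n (k + 1) ^ m * sW d n (k + 1) = u * z := fun m => by
          refine ⟨1, one_mem _, _, (tW_pow_mem_NW hd hk m).1, ?_⟩
          rw [((tW_succ_mul_sW (by omega) hk).pow_right m).eq, mul_assoc, hs, mul_one, one_mul]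
        have baser : ∀ m, ∃ u ∈ strandMonoid d n (k + 1), ∃ z ∈ NW d n (k + 2),
            sW d n (k + 1) * (rk d n (k + 1) * tW d n (k + 1) ^ m) * sW d n (k + 1) =
              u * z := fun m => by
          refine ⟨1, one_mem _, _, (tW_pow_mem_NW hd hk m).2, ?_⟩
          rw [((rk_succ_semiconj hk).mul_right
            ((tW_succ_mul_sW (by omega) hk).pow_right m)).eq, mul_assoc, hs, mul_one, one_mul]
        rcases k with _ | k
        · obtain ⟨m, -, rfl | rfl⟩ := hy
          · exact base m
          · exact baser m
        · obtain ⟨m, -, rfl | rfl⟩ | ⟨z, hz, rfl⟩ := hy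
          · exact base m
          · exact baser m
          · refine ⟨sW d n (k + 1), sW_mem_strandMonoid (by omega) (by omega),
              sW d n (k + 2) * (sW d n (k + 1) * z), Or.inr ⟨_, Or.inr ⟨z, hz, rfl⟩, rfl⟩, ?_⟩
            have hc := sW_succ_commute hk (NW_subset_strandMonoid k hz)
            calc sW d n (k + 2) * (sW d n (k + 1) * z) * sW d n (k + 2)
                = sW d n (k + 2) * sW d n (k + 1) * (z * sW d n (k + 2)) := by
                  simp only [mul_assoc]
              _ = sW d n (k + 2) * sW d n (k + 1) * sW d n (k + 2) * z := by
                  rw [← hc.eq]; simp only [mul_assoc]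
              _ = sW d n (k + 1) * (sW d n (k + 2) * (sW d n (k + 1) * z)) := by
                  rw [← sW_braid (by omega) hk]; simp only [mul_assoc]
      · refine ⟨tW d n (k + 1), tW_mem_strandMonoid (by omega) le_rfl, sW d n (k + 1) * y,
          Or.inr ⟨y, hy, rfl⟩, ?_⟩
        rw [mul_assoc, ← (tW_succ_commute hk (NW_subset_strandMonoid k hy)).eq, ← mul_assoc,
          (tW_mul_sW_self (by omega) hk).eq, mul_assoc]

theorem exists_mul_NW (hd : 1 ≤ d) (hk : k < n) {w : Wdn d n}
    (hw : w ∈ strandMonoid d n (k + 1)) :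
    ∃ u ∈ strandMonoid d n k, ∃ x ∈ NW d n (k + 1), w = u * x := by
  induction hw using Submonoid.closure_induction_right with
  | one => exact ⟨1, one_mem _, 1, one_mem_NW hd hk, (one_mul 1).symm⟩
  | mul_right w _ g hg ih =>
    obtain ⟨u, hu, x, hx, rfl⟩ := ih
    obtain ⟨v, hv, y, hy, h⟩ := NW_mul_strandGens hd hk hx hg
    exact ⟨u * v, mul_mem hu hv, y, hy, by rw [mul_assoc, h, mul_assoc]⟩

theorem exists_standard_form (hd : 1 ≤ d) (hk : k ≤ n) {w : Wdn d n}
    (hw : w ∈ strandMonoid d n k) :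
    ∃ f : Fin k → Wdn d n,
      (∀ i : Fin k, f i ∈ NW d n (i.val + 1)) ∧ w = (List.ofFn f).prod := by
  induction k generalizing w with
  | zero =>
    have h : w = 1 := by
      induction hw using Submonoid.closure_induction with
      | mem x hx => rcases hx with ⟨h1, -⟩ | ⟨i, h1, h2, -⟩ | ⟨j, h1, h2, -⟩ <;> omega
      | one => rfl
      | mul x y _ _ hx hy => rw [hx, hy, one_mul]
    exact ⟨Fin.elim0, fun i => i.elim0, by simpa using h⟩
  | succ k ih =>
    obtain ⟨u, hu, x, hx, rfl⟩ := exists_mul_NW hd hk hw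
    obtain ⟨f, hf, rfl⟩ := ih (by omega) hu
    refine ⟨Fin.snoc f x, fun i => ?_, ?_⟩
    · refine Fin.lastCases ?_ (fun j => ?_) i
      · simpa using hx
      · simpa using hf j
    · rw [List.ofFn_succ']
      simp

theorem strandMonoid_eq_top (hd : 1 ≤ d) (hn : 1 ≤ n) (w : Wdn d n) : w ∈ strandMonoid d n n := by
  obtain ⟨w, rfl⟩ : ∃ v, mkW d n v = w := PresentedGroup.mk_surjective _ w
  have hs : ∀ i : Fin (n - 1), mkW d n (FreeGroup.of (WGen.s i)) = sW d n (i + 1) := fun i => by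
    rw [sW, Fs, dif_pos (by omega)]; rfl
  have ht : ∀ j : Fin n, mkW d n (FreeGroup.of (WGen.t j)) = tW d n (j + 1) := fun j => by
    rw [tW, Ft, dif_pos (by omega)]; rfl
  have hof : ∀ g : WGen n, mkW d n (FreeGroup.of g) ∈ strandMonoid d n n := by
    rintro (_ | i | j)
    · exact rW_mem_strandMonoid hn
    · rw [hs]
      exact sW_mem_strandMonoid (by omega) (by omega)
    · rw [ht]
      exact tW_mem_strandMonoid (by omega) (by omega)
  have hfin : ∀ g : WGen n, ∃ m : ℕ,
      (mkW d n (FreeGroup.of g))⁻¹ = mkW d n (FreeGroup.of g) ^ m := by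
    rintro (_ | i | j)
    · exact ⟨1, by rw [pow_one]; exact inv_eq_of_mul_eq_one_left rW_mul_self⟩
    · rw [hs]
      exact ⟨1, by
        rw [pow_one]; exact inv_eq_of_mul_eq_one_left (sW_mul_self (by omega) (by omega))⟩
    · rw [ht]
      refine ⟨d - 1, inv_eq_of_mul_eq_one_left ?_⟩
      rw [← pow_succ, Nat.sub_add_cancel hd]
      exact tW_pow (by omega) (by omega)
  induction w using FreeGroup.induction_on with
  | C1 => rw [map_one]; exact one_mem _
  | of g => exact hof g
  | inv_of g _ =>
    obtain ⟨m, hm⟩ := hfin g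
    rw [map_inv, hm]
    exact pow_mem (hof g) m
  | mul x y hx hy => rw [map_mul]; exact mul_mem hx hy

end StrandMonoid

/-- every element of the `d`-modular framed Coxeter group of type `B_n`
can be expressed in standard form, i.e. as a product `m_1 m_2 ⋯ m_n` with
`m_i ∈ 𝙽_{d,i}` for each `1 ≤ i ≤ n`. -/
theorem stmt0 (d n : ℕ) (hd : 1 ≤ d) (hn : 2 ≤ n) :
    ∀ w : Wdn d n, ∃ f : Fin n → Wdn d n,
      (∀ i : Fin n, f i ∈ NW d n (i.val + 1)) ∧ w = (List.ofFn f).prod := by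
  intro w
  exact exists_standard_form hd le_rfl (strandMonoid_eq_top hd (by omega) w)
end
end

section
/- In Y_{d,n}^B, for 1 ≤ k ≤ n the elements b_k satisfy: (i) b_k t_j = t_j b_k for all 1 ≤ j ≤ n; and (ii) b_k g_i = g_i b_k whenever i ≤ k−2 or i ≥ k+1 (for 1 ≤ i ≤ n−1). -/
noncomputable section

/-- The field `K = ℂ(u,v)` of rational functions in two indeterminates over `ℂ`. -/
abbrev Kf : Type := FractionRing (MvPolynomial (Fin 2) ℂ)

/-- The indeterminate `u`. -/
def uu : Kf := algebraMap (MvPolynomial (Fin 2) ℂ) Kf (MvPolynomial.X 0)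

/-- The indeterminate `v`. -/
def vv : Kf := algebraMap (MvPolynomial (Fin 2) ℂ) Kf (MvPolynomial.X 1)

/-- Generators of the framization of the Hecke algebra of type B on `n` strands:
`b` is the generator `b₁`, `g i` is the braiding generator `g_{i+1}` (`i : Fin (n-1)`),
and `t j` is the framing generator `t_{j+1}` (`j : Fin n`). -/
inductive Gen (n : ℕ) : Type
  | b : Gen n
  | g : Fin (n - 1) → Gen n
  | t : Fin n → Gen n

/-- The free algebra on the generators. -/
abbrev FA (n : ℕ) : Type := FreeAlgebra Kf (Gen n)

/-- The generator `b₁` in the free algebra. -/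
def Bb (n : ℕ) : FA n := FreeAlgebra.ι Kf Gen.b

/-- The generator `g_i` (for `1 ≤ i ≤ n-1`) in the free algebra; junk value `1` out of range. -/
def Gg (n i : ℕ) : FA n :=
  if h : 1 ≤ i ∧ i ≤ n - 1 then FreeAlgebra.ι Kf (Gen.g ⟨i - 1, by omega⟩) else 1

/-- The generator `t_j` (for `1 ≤ j ≤ n`) in the free algebra; junk value `1` out of range. -/
def Tt (n j : ℕ) : FA n :=
  if h : 1 ≤ j ∧ j ≤ n then FreeAlgebra.ι Kf (Gen.t ⟨j - 1, by omega⟩) else 1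

/-- The element `e_i = (1/d) ∑_{m=0}^{d-1} t_i^m t_{i+1}^{d-m}` in the free algebra. -/
def eF (d n i : ℕ) : FA n :=
  (d : Kf)⁻¹ • ∑ m ∈ Finset.range d, Tt n i ^ m * Tt n (i + 1) ^ (d - m)

/-- The element `f₁ = (1/d) ∑_{m=0}^{d-1} t₁^m` in the free algebra. -/
def fF (d n : ℕ) : FA n :=
  (d : Kf)⁻¹ • ∑ m ∈ Finset.range d, Tt n 1 ^ m

/-- The defining relations of the framization `Y_{d,n}^B` of the Hecke algebra of type B. -/
inductive YBrel (d n : ℕ) : FA n → FA n → Prop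
  | gg : ∀ i j : ℕ, 1 ≤ i → i ≤ n - 1 → 1 ≤ j → j ≤ n - 1 → (i + 1 < j ∨ j + 1 < i) →
      YBrel d n (Gg n i * Gg n j) (Gg n j * Gg n i)
  | braid : ∀ i : ℕ, 1 ≤ i → i ≤ n - 2 →
      YBrel d n (Gg n i * Gg n (i + 1) * Gg n i) (Gg n (i + 1) * Gg n i * Gg n (i + 1))
  | bg : ∀ i : ℕ, 2 ≤ i → i ≤ n - 1 → YBrel d n (Bb n * Gg n i) (Gg n i * Bb n)
  | bgbg : YBrel d n (Bb n * Gg n 1 * Bb n * Gg n 1) (Gg n 1 * Bb n * Gg n 1 * Bb n)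
  | tt : ∀ i j : ℕ, 1 ≤ i → i ≤ n → 1 ≤ j → j ≤ n →
      YBrel d n (Tt n i * Tt n j) (Tt n j * Tt n i)
  | tg : ∀ i j : ℕ, 1 ≤ i → i ≤ n - 1 → 1 ≤ j → j ≤ n →
      YBrel d n (Tt n j * Gg n i) (Gg n i * Tt n (sAct i j))
  | tb : ∀ i : ℕ, 1 ≤ i → i ≤ n → YBrel d n (Tt n i * Bb n) (Bb n * Tt n i)
  | td : ∀ i : ℕ, 1 ≤ i → i ≤ n → YBrel d n (Tt n i ^ d) 1
  | gsq : ∀ i : ℕ, 1 ≤ i → i ≤ n - 1 →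
      YBrel d n (Gg n i ^ 2) (1 + (uu - uu⁻¹) • (eF d n i * Gg n i))
  | bsq : YBrel d n (Bb n ^ 2) (1 + (vv - vv⁻¹) • (fF d n * Bb n))

/-- The framization of the Hecke algebra of type B, `Y_{d,n}^B`. -/
abbrev YB (d n : ℕ) : Type := RingQuot (YBrel d n)

instance (d n : ℕ) : Ring (YB d n) := RingQuot.instRing (YBrel d n)

instance (d n : ℕ) : Algebra Kf (YB d n) := RingQuot.instAlgebra _

instance (d n : ℕ) : Module Kf (YB d n) := Algebra.toModule

/-- The canonical projection from the free algebra onto `Y_{d,n}^B`. -/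
def mkY (d n : ℕ) : FA n →ₐ[Kf] YB d n := RingQuot.mkAlgHom Kf (YBrel d n)

/-- The generator `b₁` of `Y_{d,n}^B`. -/
def bY (d n : ℕ) : YB d n := mkY d n (Bb n)

/-- The generator `g_i` of `Y_{d,n}^B`. -/
def gY (d n : ℕ) (i : ℕ) : YB d n := mkY d n (Gg n i)

/-- The generator `t_j` of `Y_{d,n}^B`. -/
def tY (d n : ℕ) (j : ℕ) : YB d n := mkY d n (Tt n j)

/-- The idempotent `e_i` of `Y_{d,n}^B`. -/
def eY (d n : ℕ) (i : ℕ) : YB d n := mkY d n (eF d n i)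

/-- The idempotent `f₁` of `Y_{d,n}^B`. -/
def fY (d n : ℕ) : YB d n := mkY d n (fF d n)

/-- The element `g_i⁻¹ = g_i - (u - u⁻¹) e_i`. -/
def gInv (d n i : ℕ) : YB d n := gY d n i - (uu - uu⁻¹) • eY d n i

/-- The elements `b_k := g_{k-1} ⋯ g_1 b_1 g_1⁻¹ ⋯ g_{k-1}⁻¹` for `2 ≤ k ≤ n`,
defined by `b_k = g_{k-1} b_{k-1} g_{k-1}⁻¹`; with `b_1` the generator `b₁`. -/
def bk (d n : ℕ) : ℕ → YB d n
  | 0 => 1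
  | 1 => bY d n
  | (k + 2) => gY d n (k + 1) * bk d n (k + 1) * gInv d n (k + 1)

theorem SemiconjBy.commute_conj {M : Type*} [Monoid M] {u : Mˣ} {x y z : M}
    (h : SemiconjBy (u : M) x y) (hz : Commute x z) :
    Commute y (u * z * (u⁻¹ : Mˣ)) := by
  have h' : SemiconjBy ((u⁻¹ : Mˣ) : M) y x := h.units_inv_symm_left
  calc y * (u * z * (u⁻¹ : Mˣ)) = (y * u) * z * (u⁻¹ : Mˣ) := by simp only [mul_assoc]
    _ = u * (x * z) * (u⁻¹ : Mˣ) := by rw [← h.eq]; simp only [mul_assoc]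
    _ = u * z * (x * (u⁻¹ : Mˣ)) := by rw [hz.eq]; simp only [mul_assoc]
    _ = u * z * (u⁻¹ : Mˣ) * y := by rw [← h'.eq]; simp only [mul_assoc]

theorem mkY_eq_of_rel {d n : ℕ} {x y : FA n} (h : YBrel d n x y) : mkY d n x = mkY d n y :=
  RingQuot.mkAlgHom_rel Kf h

theorem semiconjBy_gY_tY (d : ℕ) {n i j : ℕ} (hi : 1 ≤ i) (hin : i ≤ n - 1) (hj : 1 ≤ j)
    (hjn : j ≤ n) : SemiconjBy (gY d n i) (tY d n (sAct i j)) (tY d n j) := by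
  have h := mkY_eq_of_rel (YBrel.tg (d := d) i j hi hin hj hjn)
  rw [map_mul, map_mul] at h
  exact h.symm

theorem commute_tY (d : ℕ) {n i j : ℕ} (hi : 1 ≤ i) (hin : i ≤ n) (hj : 1 ≤ j)
    (hjn : j ≤ n) : Commute (tY d n i) (tY d n j) := by
  have h := mkY_eq_of_rel (YBrel.tt (d := d) i j hi hin hj hjn)
  rwa [map_mul, map_mul] at h

theorem tY_pow_d (d : ℕ) {n i : ℕ} (hi : 1 ≤ i) (hin : i ≤ n) : tY d n i ^ d = 1 := by
  have h := mkY_eq_of_rel (YBrel.td (d := d) i hi hin)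
  rwa [map_pow, map_one] at h

theorem commute_tY_bY (d : ℕ) {n i : ℕ} (hi : 1 ≤ i) (hin : i ≤ n) :
    Commute (tY d n i) (bY d n) := by
  have h := mkY_eq_of_rel (YBrel.tb (d := d) i hi hin)
  rwa [map_mul, map_mul] at h

theorem commute_gY_bY (d : ℕ) {n i : ℕ} (hi : 2 ≤ i) (hin : i ≤ n - 1) :
    Commute (gY d n i) (bY d n) := by
  have h := mkY_eq_of_rel (YBrel.bg (d := d) i hi hin)
  rw [map_mul, map_mul] at h
  exact h.symm

theorem commute_gY (d : ℕ) {n i j : ℕ} (hi : 1 ≤ i) (hin : i ≤ n - 1) (hj : 1 ≤ j)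
    (hjn : j ≤ n - 1) (hij : i + 1 < j ∨ j + 1 < i) : Commute (gY d n i) (gY d n j) := by
  have h := mkY_eq_of_rel (YBrel.gg (d := d) i j hi hin hj hjn hij)
  rwa [map_mul, map_mul] at h

theorem semiconjBy_gY_mul_gY (d : ℕ) {n i : ℕ} (hi : 1 ≤ i) (hin : i ≤ n - 2) :
    SemiconjBy (gY d n (i + 1) * gY d n i) (gY d n (i + 1)) (gY d n i) := by
  have h := mkY_eq_of_rel (YBrel.braid (d := d) i hi hin)
  simp only [map_mul] at h
  rw [SemiconjBy, ← mul_assoc]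
  exact h.symm

theorem gY_sq (d : ℕ) {n i : ℕ} (hi : 1 ≤ i) (hin : i ≤ n - 1) :
    gY d n i * gY d n i = 1 + (uu - uu⁻¹) • (eY d n i * gY d n i) := by
  have h := mkY_eq_of_rel (YBrel.gsq (d := d) i hi hin)
  rw [pow_two, map_mul, map_add, map_one, map_smul, map_mul] at h
  exact h

theorem eY_eq_sum (d n i : ℕ) : eY d n i =
    (d : Kf)⁻¹ • ∑ m ∈ Finset.range d, tY d n i ^ m * tY d n (i + 1) ^ (d - m) := by
  simp only [eY, eF, tY, map_smul, map_sum, map_mul, map_pow]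

/-- If `x ^ d = y ^ d`, then `∑ xᵐ yᵈ⁻ᵐ` is symmetric in commuting `x` and `y`. -/
theorem sum_range_pow_mul_pow_swap {R : Type*} [Semiring R] {x y : R} {d : ℕ}
    (hxy : Commute x y) (hd : x ^ d = y ^ d) :
    ∑ m ∈ Finset.range d, x ^ m * y ^ (d - m) = ∑ m ∈ Finset.range d, y ^ m * x ^ (d - m) := by
  cases d with
  | zero => simp
  | succ k =>
    rw [Finset.sum_range_succ', Finset.sum_range_succ' (fun m => y ^ m * x ^ (k + 1 - m)),
      ← Finset.sum_range_reflect]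
    congr 1
    · refine Finset.sum_congr rfl fun m hm => ?_
      have hm' := Finset.mem_range.mp hm
      rw [(hxy.pow_pow _ _).eq]
      congr 2 <;> omega
    · simp [hd]

theorem commute_gY_eY (d : ℕ) {n i : ℕ} (hi : 1 ≤ i) (hin : i ≤ n - 1) :
    Commute (gY d n i) (eY d n i) := by
  have h₁ : SemiconjBy (gY d n i) (tY d n (i + 1)) (tY d n i) := by
    simpa [sAct] using semiconjBy_gY_tY d hi hin hi (by omega)
  have h₂ : SemiconjBy (gY d n i) (tY d n i) (tY d n (i + 1)) := by
    simpa [sAct] using semiconjBy_gY_tY d hi hin (j := i + 1) (by omega) (by omega)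
  have hswap := sum_range_pow_mul_pow_swap (d := d)
    (commute_tY d hi (by omega) (n := n) (j := i + 1) (by omega) (by omega))
    (by rw [tY_pow_d d hi (by omega), tY_pow_d d (by omega) (by omega)])
  rw [eY_eq_sum, Commute, SemiconjBy, mul_smul_comm, smul_mul_assoc]
  congr 1
  conv_lhs => rw [hswap]
  rw [Finset.mul_sum, Finset.sum_mul]
  exact Finset.sum_congr rfl fun m _ => ((h₁.pow_right m).mul_right (h₂.pow_right (d - m))).eq

theorem exists_unit_gY (d : ℕ) {n i : ℕ} (hi : 1 ≤ i) (hin : i ≤ n - 1) :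
    ∃ w : (YB d n)ˣ, (w : YB d n) = gY d n i ∧ ((w⁻¹ : (YB d n)ˣ) : YB d n) = gInv d n i := by
  refine ⟨⟨gY d n i, gInv d n i, ?_, ?_⟩, rfl, rfl⟩
  · rw [gInv, mul_sub, mul_smul_comm, (commute_gY_eY d hi hin).eq, gY_sq d hi hin,
      add_sub_cancel_right]
  · rw [gInv, sub_mul, smul_mul_assoc, gY_sq d hi hin, add_sub_cancel_right]

theorem commute_bk_succ_of_semiconjBy (d : ℕ) {n k : ℕ} (hk : 1 ≤ k) (hkn : k + 1 ≤ n)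
    {x y : YB d n} (h : SemiconjBy (gY d n k) x y) (hx : Commute x (bk d n k)) :
    Commute y (bk d n (k + 1)) := by
  obtain ⟨m, rfl⟩ : ∃ m, k = m + 1 := ⟨k - 1, by omega⟩
  obtain ⟨w, hw, hw'⟩ := exists_unit_gY d (n := n) (i := m + 1) hk (by omega)
  rw [← hw] at h
  rw [bk, ← hw, ← hw']
  exact h.commute_conj hx

theorem commute_tY_bk (d : ℕ) {n k : ℕ} (hk : 1 ≤ k) (hkn : k ≤ n) :
    ∀ j, 1 ≤ j → j ≤ n → Commute (tY d n j) (bk d n k) := by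
  induction k, hk using Nat.le_induction with
  | base => exact fun j hj hjn => commute_tY_bY d hj hjn
  | succ k hk ih =>
    intro j hj hjn
    refine commute_bk_succ_of_semiconjBy d hk hkn
      (semiconjBy_gY_tY d hk (by omega) hj hjn) (ih (by omega) _ ?_ ?_) <;>
    · unfold sAct
      split_ifs <;> omega

theorem commute_gY_bk_of_lt (d : ℕ) {n i k : ℕ} (hk : 1 ≤ k) (hki : k < i) (hin : i ≤ n - 1) :
    Commute (gY d n i) (bk d n k) := by
  induction k, hk using Nat.le_induction with
  | base => exact commute_gY_bY d hki hin
  | succ k hk ih =>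
    exact commute_bk_succ_of_semiconjBy d hk (by omega)
      (commute_gY d hk (by omega) (by omega) hin (by omega)) (ih (by omega))

theorem commute_gY_bk_of_add_two_le (d : ℕ) {n i k : ℕ} (hi : 1 ≤ i) (hik : i + 2 ≤ k)
    (hkn : k ≤ n) : Commute (gY d n i) (bk d n k) := by
  induction k, hik using Nat.le_induction with
  | base =>
    obtain ⟨m, rfl⟩ : ∃ m, i = m + 1 := ⟨i - 1, by omega⟩
    obtain ⟨w₁, hw₁, hw₁'⟩ := exists_unit_gY d (n := n) (i := m + 1) hi (by omega)
    obtain ⟨w₂, hw₂, hw₂'⟩ := exists_unit_gY d (n := n) (i := m + 2) (by omega) (by omega)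
    have h := semiconjBy_gY_mul_gY d hi (show m + 1 ≤ n - 2 by omega)
    have hc := commute_gY_bk_of_lt d hi (show m + 1 < m + 2 by omega)
      (show m + 2 ≤ n - 1 by omega)
    have key := SemiconjBy.commute_conj (u := w₂ * w₁)
      (by rw [Units.val_mul, hw₁, hw₂]; exact h) hc
    rw [mul_inv_rev, Units.val_mul, Units.val_mul, hw₁, hw₁', hw₂, hw₂'] at key
    rw [bk, bk]
    simpa only [mul_assoc] using key
  | succ k hk ih =>
    exact commute_bk_succ_of_semiconjBy d (by omega) hkn
      (commute_gY d (by omega) (by omega) hi (by omega) (by omega)) (ih (by omega))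

/-- the elements `b_k` commute with all framing generators `t_j`, and with the
braiding generators `g_i` whenever `i ≤ k-2` or `i ≥ k+1`. -/
theorem stmt2 (d n : ℕ) (hd : 1 ≤ d) (hn : 2 ≤ n) :
    (∀ k j, 1 ≤ k → k ≤ n → 1 ≤ j → j ≤ n →
      bk d n k * tY d n j = tY d n j * bk d n k) ∧
    (∀ k i, 1 ≤ k → k ≤ n → 1 ≤ i → i ≤ n - 1 → (i + 2 ≤ k ∨ k + 1 ≤ i) →
      bk d n k * gY d n i = gY d n i * bk d n k) := by
  exact ⟨fun k j hk hkn hj hjn => (commute_tY_bk d hk hkn j hj hjn).eq.symm,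
    fun k i hk hkn hi hin hik => hik.elim
      (fun h => (commute_gY_bk_of_add_two_le d hi h hkn).eq.symm)
      (fun h => (commute_gY_bk_of_lt d hk h hin).eq.symm)⟩
end
end

section
/- There is a homomorphism of unital K-algebras Φ : Y_{d,n}^B → End(V^{⊗n}) with Φ(b_1) = B_1, Φ(g_i) = G_i for 1 ≤ i ≤ n−1, and Φ(t_i) = T_i for 1 ≤ i ≤ n. -/
set_option maxHeartbeats 1000000
set_option synthInstance.maxHeartbeats 400000

noncomputable section

/-- The index set `X_n = {-n, …, -1, 1, …, n}`. -/
abbrev Xn (n : ℕ) : Type := {i : ℤ // i ≠ 0 ∧ i.natAbs ≤ n}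

/-- Negation on `X_n`. -/
def negX (n : ℕ) (x : Xn n) : Xn n :=
  ⟨-x.val, by obtain ⟨h1, h2⟩ := x.2; omega⟩

/-- The index set of the natural basis of `V^{⊗n}`: a basis vector
`v_{i_1}^{r_1} ⊗ ⋯ ⊗ v_{i_n}^{r_n}` corresponds to the function `p ↦ (i_{p+1}, r_{p+1})`. -/
abbrev BIdx (d n : ℕ) : Type := Fin n → Xn n × Fin d

/-- The vector space `V^{⊗n}`, realized as the space with basis indexed by `BIdx d n`. -/
abbrev Vn (d n : ℕ) : Type := BIdx d n →₀ Kf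

/-- The basis vector of `V^{⊗n}` indexed by `f`. -/
def bv (d n : ℕ) (f : BIdx d n) : Vn d n := Finsupp.single f 1

/-- The endomorphism of `V^{⊗n}` with prescribed values on the basis. -/
def opOf (d n : ℕ) (F : BIdx d n → Vn d n) : Module.End Kf (Vn d n) :=
  Finsupp.linearCombination Kf F

/-- The image in `K` of a complex number (in particular of the root of unity `ω`). -/
def cK (w : ℂ) : Kf := algebraMap (MvPolynomial (Fin 2) ℂ) Kf (MvPolynomial.C w)

/-- The endomorphism `T_k = 1⊗⋯⊗T⊗⋯⊗1` of `V^{⊗n}` (for `1 ≤ k ≤ n`; junk `1` out of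
range), where `(v_i^r) T = ω^r v_i^r`. -/
def TOp (w : ℂ) (d n k : ℕ) : Module.End Kf (Vn d n) :=
  if h : 1 ≤ k ∧ k ≤ n then
    opOf d n (fun f => cK w ^ ((f ⟨k - 1, by omega⟩).2 : ℕ) • bv d n f)
  else 1

/-- The inverse `T_k⁻¹` of the endomorphism `T_k`. -/
def TinvOp (w : ℂ) (d n k : ℕ) : Module.End Kf (Vn d n) :=
  if h : 1 ≤ k ∧ k ≤ n then
    opOf d n (fun f => (cK w ^ ((f ⟨k - 1, by omega⟩).2 : ℕ))⁻¹ • bv d n f)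
  else 1

/-- The endomorphism `E_k = (1/d) ∑_{m=0}^{d-1} T_k^m T_{k+1}^{-m}`. -/
def EOp (w : ℂ) (d n k : ℕ) : Module.End Kf (Vn d n) :=
  (d : Kf)⁻¹ • ∑ m ∈ Finset.range d, TOp w d n k ^ m * TinvOp w d n (k + 1) ^ m

/-- The endomorphism `F = (1/d) ∑_{m=0}^{d-1} T_1^m`. -/
def FOp (w : ℂ) (d n : ℕ) : Module.End Kf (Vn d n) :=
  (d : Kf)⁻¹ • ∑ m ∈ Finset.range d, TOp w d n 1 ^ m

/-- The endomorphism `G_i = 1⊗⋯⊗G⊗⋯⊗1` of `V^{⊗n}` (acting on the tensor factors `i`,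
`i+1`, for `1 ≤ i ≤ n-1`; junk `1` out of range). -/
def GOp (d n i : ℕ) : Module.End Kf (Vn d n) :=
  if h : 1 ≤ i ∧ i ≤ n - 1 then
    opOf d n (fun f =>
      let p : Fin n := ⟨i - 1, by omega⟩
      let q : Fin n := ⟨i, by omega⟩
      let fs : BIdx d n := f ∘ (Equiv.swap p q)
      if (f p).2 ≠ (f q).2 then bv d n fs
      else if (f p).1.val = (f q).1.val then uu • bv d n fs
      else if (f p).1.val < (f q).1.val then bv d n fs
      else bv d n fs + (uu - uu⁻¹) • bv d n f)
  else 1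

/-- The endomorphism `B_1` of `V^{⊗n}`. -/
def BOp (d n : ℕ) : Module.End Kf (Vn d n) :=
  if h : 1 ≤ n then
    opOf d n (fun f =>
      let p : Fin n := ⟨0, by omega⟩
      let fneg : BIdx d n := Function.update f p (negX n (f p).1, (f p).2)
      if ((f p).2 : ℕ) ≠ 0 then bv d n fneg
      else if 0 < (f p).1.val then bv d n fneg
      else bv d n fneg + (vv - vv⁻¹) • bv d n f)
  else 1

section
variable {K X R M : Type*} [CommRing K] [LinearOrder X] [DecidableEq R] [AddCommGroup M]
  [Module K M]

/-- The coefficient of the transposed tensor in the image of a pure tensor under `G`. -/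
def swapCoeff (q : K) (a b : X × R) : K := if a = b then q else 1

/-- The coefficient of the original tensor in the image of a pure tensor under `G`. -/
def stayCoeff (c : K) (a b : X × R) : K := if a.2 = b.2 ∧ b.1 < a.1 then c else 0

theorem quadratic_of_local {q c : K} (hq : q * q = 1 + c * q) {G : Module.End K M}
    {F : X × R → X × R → M}
    (hG : ∀ a b, G (F a b) = swapCoeff q a b • F b a + stayCoeff c a b • F a b)
    (a b : X × R) :
    G (G (F a b)) = F a b + c • (if a.2 = b.2 then (1 : K) else 0) • G (F a b) := by
  obtain ⟨x, r⟩ := a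
  obtain ⟨y, s⟩ := b
  simp only [hG, map_add, map_smul]
  by_cases hrs : r = s
  · subst hrs
    rcases lt_trichotomy x y with h | h | h
    · simp [swapCoeff, stayCoeff, h, h.ne, h.ne', h.not_gt, Prod.ext_iff]
    · subst h
      simp only [swapCoeff, stayCoeff, lt_irrefl, and_false, if_true, if_false]
      match_scalars
      linear_combination hq
    · simp [swapCoeff, stayCoeff, h, h.ne, h.ne', h.not_gt, Prod.ext_iff]
  · simp [swapCoeff, stayCoeff, hrs, Ne.symm hrs, Prod.ext_iff, eq_comm]

theorem coeff_cases (q c : K) (a b : X × R) :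
    a = b ∨
    (a.2 ≠ b.2 ∧ swapCoeff q a b = 1 ∧ swapCoeff q b a = 1 ∧
      stayCoeff c a b = 0 ∧ stayCoeff c b a = 0) ∨
    ((a.2 = b.2 ∧ a.1 < b.1) ∧ swapCoeff q a b = 1 ∧ swapCoeff q b a = 1 ∧
      stayCoeff c a b = 0 ∧ stayCoeff c b a = c) ∨
    ((a.2 = b.2 ∧ b.1 < a.1) ∧ swapCoeff q a b = 1 ∧ swapCoeff q b a = 1 ∧
      stayCoeff c a b = c ∧ stayCoeff c b a = 0) := by
  obtain ⟨x, r⟩ := a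
  obtain ⟨y, s⟩ := b
  by_cases h : r = s
  · rcases lt_trichotomy x y with h' | h' | h' <;>
      simp [swapCoeff, stayCoeff, h, h', ne_of_lt, ne_of_gt, le_of_lt]
  · simp [swapCoeff, stayCoeff, h, Ne.symm h]

theorem swapCoeff_self (q : K) (a : X × R) : swapCoeff q a a = q := if_pos rfl

theorem stayCoeff_self (c : K) (a : X × R) : stayCoeff c a a = 0 := if_neg (by simp)

theorem braid_of_local {q c : K} (hq : q * q = 1 + c * q) {G H : Module.End K M}
    {F : X × R → X × R → X × R → M}
    (hG : ∀ a b e, G (F a b e) = swapCoeff q a b • F b a e + stayCoeff c a b • F a b e)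
    (hH : ∀ a b e, H (F a b e) = swapCoeff q b e • F a e b + stayCoeff c b e • F a b e)
    (a b e : X × R) :
    G (H (G (F a b e))) = H (G (H (F a b e))) := by
  rcases coeff_cases q c a b with h1 | ⟨h1, p1, p2, p3, p4⟩ | ⟨h1, p1, p2, p3, p4⟩ |
    ⟨h1, p1, p2, p3, p4⟩ <;>
  rcases coeff_cases q c b e with h2 | ⟨h2, q1, q2, q3, q4⟩ | ⟨h2, q1, q2, q3, q4⟩ |
    ⟨h2, q1, q2, q3, q4⟩ <;>
  rcases coeff_cases q c a e with h3 | ⟨h3, r1, r2, r3, r4⟩ | ⟨h3, r1, r2, r3, r4⟩ |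
    ⟨h3, r1, r2, r3, r4⟩ <;>
  first
  | (exfalso; grind)
  | (try subst h1
     try subst h2
     try subst h3
     simp only [map_add, map_smul, swapCoeff_self, stayCoeff_self, *]
     try match_scalars <;> first | ring1 | linear_combination c * hq | linear_combination -c * hq)

theorem typeB_braid_of_lt {q c : K} (k : K) (hq : q * q = 1 + c * q) {ν : X → X}
    (hν : ∀ x, ν (ν x) = x) (hanti : ∀ x y, x < y → ν y < ν x) (hne : ∀ x, ν x ≠ x) {G B : Module.End K M}
    {f : X → X → M} (hGlt : ∀ x y, x < y → G (f x y) = f y x)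
    (hGgt : ∀ x y, y < x → G (f x y) = f y x + c • f x y) (hGeq : ∀ x, G (f x x) = q • f x x)
    (hBpos : ∀ x y, ν x < x → B (f x y) = f (ν x) y)
    (hBneg : ∀ x y, x < ν x → B (f x y) = f (ν x) y + k • f x y) (x y : X) :
    B (G (B (G (f x y)))) = G (B (G (B (f x y)))) := by
  have hBpos' : ∀ x y, ν x < x → B (f (ν x) y) = f x y + k • f (ν x) y := fun x y h ↦ by
    rw [hBneg _ _ (by rwa [hν]), hν]
  have hBneg' : ∀ x y, x < ν x → B (f (ν x) y) = f x y := fun x y h ↦ by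
    rw [hBpos _ _ (by rwa [hν]), hν]
  have hlt : ∀ x y, x < ν y → y < ν x := fun x y h ↦ by simpa only [hν] using hanti _ _ h
  have hgt : ∀ x y, ν y < x → ν x < y := fun x y h ↦ by simpa only [hν] using hanti _ _ h
  rcases lt_or_gt_of_ne (hne y) with hy | hy <;>
  rcases lt_trichotomy x (ν y) with h2 | rfl | h2
  case inl.inr.inl | inr.inr.inl =>
    simp (disch := assumption) only [hGlt, hGgt, hGeq, hBpos, hBneg, hBpos', hBneg',
      map_add, map_smul]
    try match_scalars <;> first | ring1 | linear_combination k * hq | linear_combination -k * hq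
  all_goals
    first | have h2' := hlt _ _ h2 | have h2' := hgt _ _ h2
    rcases lt_or_gt_of_ne (hne x) with hx | hx <;>
    rcases lt_trichotomy x y with h1 | rfl | h1 <;>
      try have h1' := hanti _ _ h1
  all_goals first
    | (exfalso; order)
    | (simp (disch := assumption) only [hGlt, hGgt, hGeq, hBpos, hBneg, hBpos', hBneg',
        map_add, map_smul]
       try match_scalars <;> first | ring1 | linear_combination k * hq)

theorem typeB_braid_of_local {q c : K} (k : K) (hq : q * q = 1 + c * q) {ν : X → X}
    (hν : ∀ x, ν (ν x) = x) (hanti : ∀ x y, x < y → ν y < ν x) (hne : ∀ x, ν x ≠ x)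
    (z : R → Prop) [DecidablePred z] {G B : Module.End K M} {F : X × R → X × R → M}
    (hG : ∀ a b, G (F a b) = swapCoeff q a b • F b a + stayCoeff c a b • F a b)
    (hB : ∀ a b, B (F a b) =
      F (ν a.1, a.2) b + (if z a.2 ∧ a.1 < ν a.1 then k else 0) • F a b)
    (a b : X × R) :
    B (G (B (G (F a b)))) = G (B (G (B (F a b)))) := by
  obtain ⟨x, r⟩ := a
  obtain ⟨y, s⟩ := b
  by_cases hrs : r = s
  · subst hrs
    refine typeB_braid_of_lt (q := q) (c := c) (if z r then k else 0) hq hν hanti hne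
      (f := fun x y ↦ F (x, r) (y, r)) ?_ ?_ ?_ ?_ ?_ x y
    · intro x y h
      simp [hG, swapCoeff, stayCoeff, h.ne, h.not_gt]
    · intro x y h
      simp [hG, swapCoeff, stayCoeff, h.ne', h]
    · intro x
      simp [hG, swapCoeff, stayCoeff]
    · intro x y h
      simp [hB, h.not_gt]
    · intro x y h
      simp [hB, h]
  · simp only [hG, hB, swapCoeff, stayCoeff, hrs, Ne.symm hrs, Prod.mk.injEq, and_false, false_and,
      if_false, map_add, map_smul]
    module
end

section
variable {d n : ℕ}

theorem opOf_bv (F : BIdx d n → Vn d n) (f : BIdx d n) : opOf d n F (bv d n f) = F f := by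
  simp [opOf, bv]

theorem end_ext {A B : Module.End Kf (Vn d n)} (h : ∀ f, A (bv d n f) = B (bv d n f)) : A = B :=
  Finsupp.lhom_ext' fun f ↦ LinearMap.ext_ring (h f)

theorem TOp_bv (w : ℂ) {k : ℕ} (p : Fin n) (hp : p.val + 1 = k) (f : BIdx d n) :
    TOp w d n k (bv d n f) = cK w ^ ((f p).2 : ℕ) • bv d n f := by
  subst hp
  rw [TOp, dif_pos ⟨by omega, p.2⟩, opOf_bv]
  rfl

theorem GOp_bv {i : ℕ} (p q : Fin n) (hp : p.val + 1 = i) (hq : q.val = i) (f : BIdx d n) :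
    GOp d n i (bv d n f) = swapCoeff uu (f p) (f q) • bv d n (f ∘ Equiv.swap p q) +
      stayCoeff (uu - uu⁻¹) (f p) (f q) • bv d n f := by
  obtain ⟨q, hqn⟩ := q
  obtain ⟨p, hpn⟩ := p
  dsimp only at hp hq
  subst hq hp
  rw [GOp, dif_pos ⟨by omega, by omega⟩, opOf_bv]
  simp only [Nat.add_sub_cancel, ne_eq, ite_not]
  generalize f ⟨p, hpn⟩ = a
  generalize f ⟨p + 1, hqn⟩ = b
  obtain ⟨x, r⟩ := a
  obtain ⟨y, s⟩ := b
  by_cases h : r = s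
  · rcases lt_trichotomy x y with h' | h' | h'
    · have h'' : x.val < y.val := h'
      simp [swapCoeff, stayCoeff, h, h'.ne, h'.not_gt, h'', h''.ne]
    · simp [swapCoeff, stayCoeff, h, h']
    · have h'' : y.val < x.val := h'
      simp [swapCoeff, stayCoeff, h, h'.ne', h', h''.not_gt, h''.ne']
  · simp [swapCoeff, stayCoeff, h]

theorem BOp_bv (p : Fin n) (hp : p.val = 0) (f : BIdx d n) :
    BOp d n (bv d n f) = bv d n (Function.update f p (negX n (f p).1, (f p).2)) +
      (if ((f p).2 : ℕ) = 0 ∧ (f p).1 < negX n (f p).1 then vv - vv⁻¹ else 0) • bv d n f := by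
  obtain ⟨p, hpn⟩ := p
  dsimp only at hp
  subst hp
  rw [BOp, dif_pos (by omega), opOf_bv]
  dsimp only
  have h : (f ⟨0, hpn⟩).1 < negX n (f ⟨0, hpn⟩).1 ↔ ¬ 0 < (f ⟨0, hpn⟩).1.val := by
    have := (f ⟨0, hpn⟩).1.2.1
    rw [← Subtype.coe_lt_coe]
    simp only [negX]
    omega
  simp only [h]
  split_ifs <;> simp_all

theorem negX_negX (x : Xn n) : negX n (negX n x) = x := Subtype.ext (neg_neg _)

theorem negX_lt_negX (x y : Xn n) (h : x < y) : negX n y < negX n x :=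
  neg_lt_neg (show x.val < y.val from h)

theorem negX_ne (x : Xn n) : negX n x ≠ x := by
  have := x.2.1
  rw [Ne, Subtype.ext_iff]
  simp only [negX]
  omega

theorem uu_mul_uu : uu * uu = 1 + (uu - uu⁻¹) * uu := by
  have h : uu ≠ 0 := by
    simp [uu, MvPolynomial.X_ne_zero]
  field_simp
  ring

theorem isPrimitiveRoot_cK {w : ℂ} (hw : IsPrimitiveRoot w d) : IsPrimitiveRoot (cK w) d :=
  hw.map_of_injective (f := (algebraMap (MvPolynomial (Fin 2) ℂ) Kf).comp MvPolynomial.C)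
    ((IsFractionRing.injective (MvPolynomial (Fin 2) ℂ) Kf).comp (MvPolynomial.C_injective _ _))

theorem GOp_comm {i j : ℕ} (hi : 1 ≤ i) (hi' : i ≤ n - 1) (hj : 1 ≤ j) (hj' : j ≤ n - 1)
    (hij : i + 1 < j ∨ j + 1 < i) : GOp d n i * GOp d n j = GOp d n j * GOp d n i := by
  refine end_ext fun f ↦ ?_
  let p : Fin n := ⟨i - 1, by omega⟩
  let q : Fin n := ⟨i, by omega⟩
  let r : Fin n := ⟨j - 1, by omega⟩
  let s : Fin n := ⟨j, by omega⟩
  have hpr : p ≠ r := Fin.ne_of_val_ne (by simp only [p, r]; omega)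
  have hps : p ≠ s := Fin.ne_of_val_ne (by simp only [p, s]; omega)
  have hqr : q ≠ r := Fin.ne_of_val_ne (by simp only [q, r]; omega)
  have hqs : q ≠ s := Fin.ne_of_val_ne (by simp only [q, s]; omega)
  have hG := GOp_bv (d := d) (i := i) p q (by simp only [p]; omega) rfl
  have hH := GOp_bv (d := d) (i := j) r s (by simp only [r]; omega) rfl
  have hcomm : (f ∘ Equiv.swap r s) ∘ Equiv.swap p q = (f ∘ Equiv.swap p q) ∘ Equiv.swap r s := by
    rw [Function.comp_assoc, Function.comp_assoc]
    congr 1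
    ext x
    simp only [Function.comp_apply, Equiv.swap_apply_def]
    grind
  simp only [Module.End.mul_apply, hG, hH, map_add, map_smul, hcomm, Function.comp_apply,
    Equiv.swap_apply_of_ne_of_ne hpr hps, Equiv.swap_apply_of_ne_of_ne hqr hqs,
    Equiv.swap_apply_of_ne_of_ne hpr.symm hqr.symm, Equiv.swap_apply_of_ne_of_ne hps.symm hqs.symm]
  simp only [smul_add, smul_smul, mul_comm]
  abel

theorem GOp_braid {i : ℕ} (hi : 1 ≤ i) (hi' : i ≤ n - 2) :
    GOp d n i * GOp d n (i + 1) * GOp d n i = GOp d n (i + 1) * GOp d n i * GOp d n (i + 1) := by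
  refine end_ext fun f ↦ ?_
  let p : Fin n := ⟨i - 1, by omega⟩
  let q : Fin n := ⟨i, by omega⟩
  let r : Fin n := ⟨i + 1, by omega⟩
  have hpq : p ≠ q := Fin.ne_of_val_ne (by simp only [p, q]; omega)
  have hpr : p ≠ r := Fin.ne_of_val_ne (by simp only [p, r]; omega)
  have hqr : q ≠ r := Fin.ne_of_val_ne (by simp only [q, r]; omega)
  have hG := GOp_bv (d := d) (i := i) p q (by simp only [p]; omega) rfl
  have hH := GOp_bv (d := d) (i := i + 1) q r rfl rfl
  let P (a b e : Xn n × Fin d) : BIdx d n :=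
    fun x ↦ if x = p then a else if x = q then b else if x = r then e else f x
  have hPp (a b e) : P a b e p = a := if_pos rfl
  have hPq (a b e) : P a b e q = b := by simp [P, hpq.symm]
  have hPr (a b e) : P a b e r = e := by simp [P, hpr.symm, hqr.symm]
  have hP1 (a b e) : P a b e ∘ Equiv.swap p q = P b a e := by
    ext1 x
    simp only [P, Function.comp_apply, Equiv.swap_apply_def]
    grind
  have hP2 (a b e) : P a b e ∘ Equiv.swap q r = P a e b := by
    ext1 x
    simp only [P, Function.comp_apply, Equiv.swap_apply_def]
    grind
  have hPf : P (f p) (f q) (f r) = f := by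
    ext1 x
    simp only [P]
    grind
  have key := braid_of_local uu_mul_uu (G := GOp d n i) (H := GOp d n (i + 1))
    (F := fun a b e ↦ bv d n (P a b e)) (fun a b e ↦ by rw [hG, hPp, hPq, hP1])
    (fun a b e ↦ by rw [hH, hPq, hPr, hP2]) (f p) (f q) (f r)
  simpa only [hPf, Module.End.mul_apply] using key

theorem BOp_GOp_comm {i : ℕ} (hi : 2 ≤ i) (hi' : i ≤ n - 1) :
    BOp d n * GOp d n i = GOp d n i * BOp d n := by
  refine end_ext fun f ↦ ?_
  let o : Fin n := ⟨0, by omega⟩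
  let p : Fin n := ⟨i - 1, by omega⟩
  let q : Fin n := ⟨i, by omega⟩
  have hop : o ≠ p := Fin.ne_of_val_ne (by simp only [o, p]; omega)
  have hoq : o ≠ q := Fin.ne_of_val_ne (by simp only [o, q]; omega)
  have hG := GOp_bv (d := d) (i := i) p q (by simp only [p]; omega) rfl
  have hB := BOp_bv (d := d) o rfl
  have hcomm (a) : Function.update (f ∘ Equiv.swap p q) o a =
      Function.update f o a ∘ Equiv.swap p q := by
    ext1 x
    simp only [Function.comp_apply, Function.update_apply, Equiv.swap_apply_def]
    grind
  simp only [Module.End.mul_apply, hG, hB, map_add, map_smul, Function.comp_apply, hcomm,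
    Equiv.swap_apply_of_ne_of_ne hop hoq, Function.update_of_ne hop.symm,
    Function.update_of_ne hoq.symm]
  simp only [smul_add, smul_smul, mul_comm]
  abel

theorem BOp_GOp_braid (hn : 2 ≤ n) :
    BOp d n * GOp d n 1 * BOp d n * GOp d n 1 = GOp d n 1 * BOp d n * GOp d n 1 * BOp d n := by
  refine end_ext fun f ↦ ?_
  let p : Fin n := ⟨0, by omega⟩
  let q : Fin n := ⟨1, by omega⟩
  have hpq : p ≠ q := Fin.ne_of_val_ne (by simp [p, q])
  have hG := GOp_bv (d := d) (i := 1) p q rfl rfl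
  have hB := BOp_bv (d := d) p rfl
  let P (a b : Xn n × Fin d) : BIdx d n := fun x ↦ if x = p then a else if x = q then b else f x
  have hPp (a b) : P a b p = a := if_pos rfl
  have hPq (a b) : P a b q = b := by simp [P, hpq.symm]
  have hP1 (a b) : P a b ∘ Equiv.swap p q = P b a := by
    ext1 x
    simp only [P, Function.comp_apply, Equiv.swap_apply_def]
    grind
  have hP2 (a b c) : Function.update (P a b) p c = P c b := by
    ext1 x
    simp only [P, Function.update_apply]
    grind
  have hPf : P (f p) (f q) = f := by
    ext1 x
    simp only [P]
    grind
  have key := typeB_braid_of_local (vv - vv⁻¹) uu_mul_uu negX_negX negX_lt_negX negX_ne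
    (fun r : Fin d ↦ (r : ℕ) = 0) (G := GOp d n 1) (B := BOp d n)
    (F := fun a b ↦ bv d n (P a b)) (fun a b ↦ by rw [hG, hPp, hPq, hP1])
    (fun a b ↦ by rw [hB, hPp, hP2]) (f p) (f q)
  simpa only [hPf, Module.End.mul_apply] using key

theorem TOp_comm (w : ℂ) {i j : ℕ} (hi : 1 ≤ i) (hi' : i ≤ n) (hj : 1 ≤ j) (hj' : j ≤ n) :
    TOp w d n i * TOp w d n j = TOp w d n j * TOp w d n i := by
  refine end_ext fun f ↦ ?_
  have hi := TOp_bv (d := d) (n := n) w (k := i) ⟨i - 1, by omega⟩ (by simp only; omega)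
  have hj := TOp_bv (d := d) (n := n) w (k := j) ⟨j - 1, by omega⟩ (by simp only; omega)
  simp only [Module.End.mul_apply, hi, hj, map_smul]
  rw [smul_comm]

theorem TOp_GOp (w : ℂ) {i j : ℕ} (hi : 1 ≤ i) (hi' : i ≤ n - 1) (hj : 1 ≤ j) (hj' : j ≤ n) :
    TOp w d n j * GOp d n i = GOp d n i * TOp w d n (sAct i j) := by
  refine end_ext fun f ↦ ?_
  let p : Fin n := ⟨i - 1, by omega⟩
  let q : Fin n := ⟨i, by omega⟩
  let r : Fin n := ⟨j - 1, by omega⟩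
  have hG := GOp_bv (d := d) (i := i) p q (by simp only [p]; omega) rfl
  have hT := TOp_bv (d := d) w (k := j) r (by simp only [r]; omega)
  have hT' := TOp_bv (d := d) w (k := sAct i j) (Equiv.swap p q r) (by
    simp only [Equiv.swap_apply_def, sAct, p, q, r, Fin.ext_iff]
    split_ifs <;> simp only <;> omega)
  have hstay : stayCoeff (uu - uu⁻¹) (f p) (f q) * cK w ^ ((f r).2 : ℕ) =
      stayCoeff (uu - uu⁻¹) (f p) (f q) * cK w ^ ((f (Equiv.swap p q r)).2 : ℕ) := by
    by_cases h : (f p).2 = (f q).2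
    · congr 3
      rw [Equiv.swap_apply_def]
      split_ifs with h1 h2 <;> simp [*]
    · simp [stayCoeff, h]
  simp only [Module.End.mul_apply, hG, hT, hT', map_add, map_smul, Function.comp_apply, smul_add,
    smul_smul, hstay]
  rw [mul_comm, mul_comm (stayCoeff _ _ _)]

theorem TOp_BOp (w : ℂ) (hn : 1 ≤ n) {i : ℕ} (hi : 1 ≤ i) (hi' : i ≤ n) :
    TOp w d n i * BOp d n = BOp d n * TOp w d n i := by
  refine end_ext fun f ↦ ?_
  let o : Fin n := ⟨0, by omega⟩
  let r : Fin n := ⟨i - 1, by omega⟩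
  have hB := BOp_bv (d := d) o rfl
  have hT := TOp_bv (d := d) w (k := i) r (by simp only [r]; omega)
  have hr : (Function.update f o (negX n (f o).1, (f o).2) r).2 = (f r).2 := by
    rw [Function.update_apply]
    split_ifs with h <;> simp [h]
  simp only [Module.End.mul_apply, hB, hT, map_add, map_smul, hr]
  simp only [smul_add, smul_smul, mul_comm]

theorem TOp_pow_bv (w : ℂ) {k : ℕ} (p : Fin n) (hp : p.val + 1 = k) (m : ℕ) (f : BIdx d n) :
    (TOp w d n k ^ m) (bv d n f) = (cK w ^ ((f p).2 : ℕ)) ^ m • bv d n f := by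
  induction m with
  | zero => simp
  | succ m ih =>
    rw [pow_succ, Module.End.mul_apply, TOp_bv w p hp, map_smul, ih, smul_smul, pow_succ']

theorem TOp_pow_eq_one {w : ℂ} (hw : w ^ d = 1) {i : ℕ} (hi : 1 ≤ i) (hi' : i ≤ n) :
    TOp w d n i ^ d = 1 := by
  refine end_ext fun f ↦ ?_
  have h : cK w ^ d = 1 := by simp [cK, ← map_pow, hw]
  rw [TOp_pow_bv w ⟨i - 1, by omega⟩ (by simp only; omega), pow_right_comm, h]
  simp

theorem sum_pow_mul_pow_eq_ite {K : Type*} [Field K] [CharZero K] {ζ : K}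
    (hζ : IsPrimitiveRoot ζ d) (r s : Fin d) :
    (d : K)⁻¹ * ∑ m ∈ Finset.range d, (ζ ^ (r : ℕ)) ^ m * (ζ ^ (s : ℕ)) ^ (d - m) =
      if r = s then 1 else 0 := by
  have hd : d ≠ 0 := (r.pos).ne'
  have hne : ζ ≠ 0 := hζ.ne_zero hd
  have hpow (k : ℕ) : (ζ ^ k) ^ d = 1 := by rw [pow_right_comm, hζ.pow_eq_one, one_pow]
  have hterm : ∀ m ∈ Finset.range d, (ζ ^ (r : ℕ)) ^ m * (ζ ^ (s : ℕ)) ^ (d - m) =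
      (ζ ^ (r : ℕ) / ζ ^ (s : ℕ)) ^ m := fun m hm ↦ by
    rw [pow_sub₀ _ (pow_ne_zero _ hne) (Finset.mem_range.1 hm).le, hpow, one_mul, div_pow,
      div_eq_mul_inv]
  rw [Finset.sum_congr rfl hterm]
  split_ifs with h
  · subst h
    simp [div_self (pow_ne_zero _ hne), hd]
  · have hx : ζ ^ (r : ℕ) / ζ ^ (s : ℕ) ≠ 1 := fun hx ↦
      h (Fin.ext (hζ.pow_inj r.2 s.2 ((div_eq_one_iff_eq (pow_ne_zero _ hne)).1 hx)))
    rw [geom_sum_eq hx, div_pow, hpow, hpow]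
    simp

theorem framing_idempotent_bv {w : ℂ} (hw : IsPrimitiveRoot w d) {i : ℕ} (p q : Fin n)
    (hp : p.val + 1 = i) (hq : q.val = i) (f : BIdx d n) :
    ((d : Kf)⁻¹ • ∑ m ∈ Finset.range d, TOp w d n i ^ m * TOp w d n (i + 1) ^ (d - m)) (bv d n f) =
      (if (f p).2 = (f q).2 then (1 : Kf) else 0) • bv d n f := by
  rw [← sum_pow_mul_pow_eq_ite (isPrimitiveRoot_cK hw)]
  simp only [LinearMap.smul_apply, LinearMap.sum_apply, Module.End.mul_apply,
    TOp_pow_bv w p hp, TOp_pow_bv w q (congrArg (· + 1) hq), map_smul, smul_smul,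
    ← Finset.sum_smul, mul_comm]

theorem sign_idempotent_bv {w : ℂ} (hw : IsPrimitiveRoot w d) (p : Fin n) (hp : p.val = 0)
    (f : BIdx d n) :
    ((d : Kf)⁻¹ • ∑ m ∈ Finset.range d, TOp w d n 1 ^ m) (bv d n f) =
      (if ((f p).2 : ℕ) = 0 then (1 : Kf) else 0) • bv d n f := by
  have key := sum_pow_mul_pow_eq_ite (isPrimitiveRoot_cK hw) (f p).2 ⟨0, (f p).2.pos⟩
  simp only [pow_zero, one_pow, mul_one, Fin.ext_iff] at key
  rw [← key]
  simp only [LinearMap.smul_apply, LinearMap.sum_apply,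
    TOp_pow_bv w p (congrArg (· + 1) hp), smul_smul, ← Finset.sum_smul]

theorem GOp_sq {w : ℂ} (hw : IsPrimitiveRoot w d) {i : ℕ} (hi : 1 ≤ i) (hi' : i ≤ n - 1) :
    GOp d n i ^ 2 = 1 + (uu - uu⁻¹) • (((d : Kf)⁻¹ • ∑ m ∈ Finset.range d,
      TOp w d n i ^ m * TOp w d n (i + 1) ^ (d - m)) * GOp d n i) := by
  refine end_ext fun f ↦ ?_
  let p : Fin n := ⟨i - 1, by omega⟩
  let q : Fin n := ⟨i, by omega⟩
  have hp : p.val + 1 = i := by simp only [p]; omega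
  have hpq : p ≠ q := Fin.ne_of_val_ne (by simp only [p, q]; omega)
  have hG := GOp_bv (d := d) (i := i) p q hp rfl
  have hE := framing_idempotent_bv hw p q hp rfl
  let P (a b : Xn n × Fin d) : BIdx d n := fun x ↦ if x = p then a else if x = q then b else f x
  have hPp (a b) : P a b p = a := if_pos rfl
  have hPq (a b) : P a b q = b := by simp [P, hpq.symm]
  have hP1 (a b) : P a b ∘ Equiv.swap p q = P b a := by
    ext1 x
    simp only [P, Function.comp_apply, Equiv.swap_apply_def]
    grind
  have hPf : P (f p) (f q) = f := by
    ext1 x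
    simp only [P]
    grind
  have key := quadratic_of_local uu_mul_uu (G := GOp d n i) (F := fun a b ↦ bv d n (P a b))
    (fun a b ↦ by rw [hG, hPp, hPq, hP1]) (f p) (f q)
  simp only [hPf] at key
  rw [pow_two, Module.End.mul_apply, key, LinearMap.add_apply, LinearMap.smul_apply,
    Module.End.mul_apply, hG, map_add, map_smul, map_smul, hE, hE]
  simp only [Module.End.one_apply, Function.comp_apply, Equiv.swap_apply_left,
    Equiv.swap_apply_right, eq_comm (a := (f q).2)]
  simp only [smul_add, smul_smul, mul_comm]

theorem BOp_sq {w : ℂ} (hw : IsPrimitiveRoot w d) (hn : 1 ≤ n) :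
    BOp d n ^ 2 = 1 + (vv - vv⁻¹) • (((d : Kf)⁻¹ • ∑ m ∈ Finset.range d,
      TOp w d n 1 ^ m) * BOp d n) := by
  refine end_ext fun f ↦ ?_
  let p : Fin n := ⟨0, hn⟩
  have hB := BOp_bv (d := d) p rfl
  have hF := sign_idempotent_bv hw p rfl
  have hneg : (f p).1 < negX n (f p).1 ↔ ¬ negX n (f p).1 < (f p).1 :=
    ⟨fun h ↦ h.not_gt, fun h ↦ lt_of_le_of_ne (not_lt.1 h) (negX_ne _).symm⟩
  rw [pow_two]
  simp only [Module.End.mul_apply, LinearMap.add_apply, LinearMap.smul_apply, Module.End.one_apply,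
    hB, hF, map_add, map_smul, Function.update_self, Function.update_idem, negX_negX,
    Prod.mk.eta, Function.update_eq_self]
  by_cases h0 : ((f p).2 : ℕ) = 0
  · by_cases h : negX n (f p).1 < (f p).1 <;>
      simp only [h0, hneg, h, true_and, not_true, not_false_eq_true, if_true, if_false] <;>
      simp
  · simp only [h0, false_and, if_false]
    simp
end

/-- The assignment of operators to generators. -/
def genOp (w : ℂ) (d n : ℕ) : Gen n → Module.End Kf (Vn d n)
  | .b => BOp d n
  | .g i => GOp d n (i + 1)
  | .t j => TOp w d n (j + 1)

section
variable (w : ℂ) (d n : ℕ)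

theorem lift_Bb : FreeAlgebra.lift Kf (genOp w d n) (Bb n) = BOp d n := by
  simp [Bb, genOp]

theorem lift_Gg (i : ℕ) : FreeAlgebra.lift Kf (genOp w d n) (Gg n i) = GOp d n i := by
  by_cases h : 1 ≤ i ∧ i ≤ n - 1
  · rw [Gg, dif_pos h, FreeAlgebra.lift_ι_apply, genOp, Nat.sub_add_cancel h.1]
  · rw [Gg, dif_neg h, GOp, dif_neg h, map_one]

theorem lift_Tt (j : ℕ) : FreeAlgebra.lift Kf (genOp w d n) (Tt n j) = TOp w d n j := by
  by_cases h : 1 ≤ j ∧ j ≤ n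
  · rw [Tt, dif_pos h, FreeAlgebra.lift_ι_apply, genOp, Nat.sub_add_cancel h.1]
  · rw [Tt, dif_neg h, TOp, dif_neg h, map_one]

theorem lift_eq_of_rel (hn : 2 ≤ n) (hw : IsPrimitiveRoot w d) ⦃x y : FA n⦄ (h : YBrel d n x y) :
    FreeAlgebra.lift Kf (genOp w d n) x = FreeAlgebra.lift Kf (genOp w d n) y := by
  cases h <;>
    simp only [eF, fF, map_mul, map_add, map_pow, map_one, map_smul, map_sum, lift_Bb, lift_Gg,
      lift_Tt]
  case gg i j hi hi' hj hj' hij => exact GOp_comm hi hi' hj hj' hij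
  case braid i hi hi' => exact GOp_braid hi hi'
  case bg i hi hi' => exact BOp_GOp_comm hi hi'
  case bgbg => exact BOp_GOp_braid hn
  case tt i j hi hi' hj hj' => exact TOp_comm w hi hi' hj hj'
  case tg i j hi hi' hj hj' => exact TOp_GOp w hi hi' hj hj'
  case tb i hi hi' => exact TOp_BOp w (by omega) hi hi'
  case td i hi hi' => exact TOp_pow_eq_one hw.pow_eq_one hi hi'
  case gsq i hi hi' => exact GOp_sq hw hi hi'
  case bsq => exact BOp_sq hw (by omega)
end

/-- there exists a homomorphism of unital `K`-algebras
`Φ : Y_{d,n}^B → End(V^{⊗n})` with `Φ(b₁) = B₁`, `Φ(g_i) = G_i` and `Φ(t_k) = T_k`. -/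
theorem stmt5 (d n : ℕ) (hd : 1 ≤ d) (hn : 2 ≤ n) (w : ℂ) (hw : IsPrimitiveRoot w d) :
    ∃ Φ : YB d n →ₐ[Kf] Module.End Kf (Vn d n),
      Φ (bY d n) = BOp d n ∧
      (∀ i, 1 ≤ i → i ≤ n - 1 → Φ (gY d n i) = GOp d n i) ∧
      (∀ k, 1 ≤ k → k ≤ n → Φ (tY d n k) = TOp w d n k) := by
  let Φ₀ := FreeAlgebra.lift Kf (genOp w d n)
  have hΦ (x) : RingQuot.liftAlgHom Kf ⟨Φ₀, lift_eq_of_rel w d n hn hw⟩ (mkY d n x) = Φ₀ x :=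
    RingQuot.liftAlgHom_mkAlgHom_apply Kf Φ₀ (lift_eq_of_rel w d n hn hw) x
  exact ⟨RingQuot.liftAlgHom Kf ⟨Φ₀, lift_eq_of_rel w d n hn hw⟩,
    (hΦ _).trans (lift_Bb w d n), fun i _ _ ↦ (hΦ _).trans (lift_Gg w d n i),
    fun k _ _ ↦ (hΦ _).trans (lift_Tt w d n k)⟩
end
end

section
/- The set 𝖣_n is a linear spanning set for Y_{d,n}^B over K; that is, every element of Y_{d,n}^B is a K-linear combination of products 𝔫_1 𝔫_2 ⋯ 𝔫_n with 𝔫_i ∈ N_{d,i}. -/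
noncomputable section

/-- The elements `b̄_k := g_{k-1} ⋯ g_1 b_1 g_1 ⋯ g_{k-1}`, defined by
`b̄_k = g_{k-1} b̄_{k-1} g_{k-1}`, with `b̄_1 = b_1`. -/
def bbar (d n : ℕ) : ℕ → YB d n
  | 0 => 1
  | 1 => bY d n
  | (k + 2) => gY d n (k + 1) * bbar d n (k + 1) * gY d n (k + 1)

/-- The subsets `N_{d,k}` of `Y_{d,n}^B`:
`N_{d,1} = {t₁^m, b̄₁ t₁^m}` and `N_{d,k} = {t_k^m, b̄_k t_k^m, g_{k-1} x : x ∈ N_{d,k-1}}`. -/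
def Nset (d n : ℕ) : ℕ → Set (YB d n)
  | 0 => {1}
  | 1 => {x | ∃ m ≤ d - 1, x = tY d n 1 ^ m ∨ x = bbar d n 1 * tY d n 1 ^ m}
  | (k + 2) => {x |
      (∃ m ≤ d - 1, x = tY d n (k + 2) ^ m ∨ x = bbar d n (k + 2) * tY d n (k + 2) ^ m) ∨
      ∃ y ∈ Nset d n (k + 1), x = gY d n (k + 1) * y}

/-- The set `𝖣_n` of all products `𝔫_1 𝔫_2 ⋯ 𝔫_n` with `𝔫_i ∈ N_{d,i}`. -/
def Dset (d n : ℕ) : Set (YB d n) :=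
  {x | ∃ f : Fin n → YB d n, (∀ i : Fin n, f i ∈ Nset d n (i.val + 1)) ∧
    x = (List.ofFn f).prod}

namespace YB

variable {d n : ℕ}

theorem mkY_eq {x y : FA n} (h : YBrel d n x y) : mkY d n x = mkY d n y :=
  RingQuot.mkAlgHom_rel Kf h

theorem gY_comm_gY {i j : ℕ} (hi : 1 ≤ i) (hij : i + 1 < j) (hj : j < n) :
    Commute (gY d n i) (gY d n j) := by
  have := mkY_eq (d := d) (YBrel.gg (n := n) i j hi (by omega) (by omega) (by omega) (Or.inl hij))
  simpa only [map_mul, commute_iff_eq, gY, bY, tY] using this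

theorem gY_braid {i : ℕ} (hi : 1 ≤ i) (hin : i + 1 < n) :
    gY d n i * gY d n (i + 1) * gY d n i = gY d n (i + 1) * gY d n i * gY d n (i + 1) := by
  have := mkY_eq (d := d) (YBrel.braid (n := n) i hi (by omega))
  simpa only [map_mul, commute_iff_eq, gY, bY, tY] using this

theorem bY_comm_gY {i : ℕ} (hi : 2 ≤ i) (hin : i < n) : Commute (bY d n) (gY d n i) := by
  have := mkY_eq (d := d) (YBrel.bg (n := n) i hi (by omega))
  simpa only [map_mul, commute_iff_eq, gY, bY, tY] using this

theorem bY_gY_one (d n : ℕ) :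
    bY d n * gY d n 1 * bY d n * gY d n 1 = gY d n 1 * bY d n * gY d n 1 * bY d n := by
  have := mkY_eq (d := d) (YBrel.bgbg (n := n))
  simpa only [map_mul, commute_iff_eq, gY, bY, tY] using this

theorem tY_comm_tY {i j : ℕ} (hi : 1 ≤ i) (hin : i ≤ n) (hj : 1 ≤ j) (hjn : j ≤ n) :
    Commute (tY d n i) (tY d n j) := by
  have := mkY_eq (d := d) (YBrel.tt (n := n) i j hi hin hj hjn)
  simpa only [map_mul, commute_iff_eq, gY, bY, tY] using this

theorem tY_mul_gY {i j : ℕ} (hi : 1 ≤ i) (hin : i < n) (hj : 1 ≤ j) (hjn : j ≤ n) :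
    tY d n j * gY d n i = gY d n i * tY d n (sAct i j) := by
  have := mkY_eq (d := d) (YBrel.tg (n := n) i j hi (by omega) hj hjn)
  simpa only [map_mul, commute_iff_eq, gY, bY, tY] using this

theorem tY_comm_bY {i : ℕ} (hi : 1 ≤ i) (hin : i ≤ n) : Commute (tY d n i) (bY d n) := by
  have := mkY_eq (d := d) (YBrel.tb (n := n) i hi hin)
  simpa only [map_mul, commute_iff_eq, gY, bY, tY] using this

theorem tY_pow_d {i : ℕ} (hi : 1 ≤ i) (hin : i ≤ n) : tY d n i ^ d = 1 := by
  have := mkY_eq (YBrel.td (d := d) (n := n) i hi hin)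
  simpa only [map_pow, map_one, tY] using this

theorem gY_mul_self {i : ℕ} (hi : 1 ≤ i) (hin : i < n) :
    gY d n i * gY d n i = 1 + (uu - uu⁻¹) • ((d : Kf)⁻¹ •
      ∑ m ∈ Finset.range d, tY d n i ^ m * tY d n (i + 1) ^ (d - m)) * gY d n i := by
  have := mkY_eq (YBrel.gsq (d := d) (n := n) i hi (by omega))
  simpa only [map_pow, map_one, map_mul, map_add, map_smul, map_sum, pow_two, eF, gY, tY,
    smul_mul_assoc] using this

theorem bY_mul_self (d n : ℕ) :
    bY d n * bY d n = 1 + (vv - vv⁻¹) • ((d : Kf)⁻¹ •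
      ∑ m ∈ Finset.range d, tY d n 1 ^ m) * bY d n := by
  have := mkY_eq (YBrel.bsq (d := d) (n := n))
  simpa only [map_pow, map_one, map_mul, map_add, map_smul, map_sum, pow_two, fF, bY, tY,
    smul_mul_assoc] using this

theorem tY_comm_gY {i j : ℕ} (hi : 1 ≤ i) (hin : i < n) (hj : 1 ≤ j) (hjn : j ≤ n)
    (h : j ≠ i) (h' : j ≠ i + 1) : Commute (tY d n j) (gY d n i) := by
  have := tY_mul_gY (d := d) hi hin hj hjn
  rwa [sAct, if_neg h, if_neg h'] at this

theorem tY_pow_mul_gY {i : ℕ} (hi : 1 ≤ i) (hin : i < n) (m : ℕ) :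
    tY d n i ^ m * gY d n i = gY d n i * tY d n (i + 1) ^ m := by
  have h : tY d n i * gY d n i = gY d n i * tY d n (i + 1) := by
    simpa [sAct] using tY_mul_gY (d := d) hi hin hi hin.le
  exact ((show SemiconjBy (gY d n i) (tY d n (i + 1)) (tY d n i) from h.symm).pow_right m).eq.symm

theorem tY_succ_pow_mul_gY {i : ℕ} (hi : 1 ≤ i) (hin : i < n) (m : ℕ) :
    tY d n (i + 1) ^ m * gY d n i = gY d n i * tY d n i ^ m := by
  have h : tY d n (i + 1) * gY d n i = gY d n i * tY d n i := by
    simpa [sAct] using tY_mul_gY (d := d) hi hin (Nat.le_add_left 1 i) hin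
  exact ((show SemiconjBy (gY d n i) (tY d n i) (tY d n (i + 1)) from h.symm).pow_right m).eq.symm

theorem bbar_succ {k : ℕ} (hk : 1 ≤ k) :
    bbar d n (k + 1) = gY d n k * bbar d n k * gY d n k := by
  obtain ⟨k, rfl⟩ := Nat.exists_eq_add_of_le' hk
  rfl

theorem tY_comm_bbar {i k : ℕ} (hi : 1 ≤ i) (hin : i ≤ n) (hk : 1 ≤ k) (hkn : k ≤ n) :
    Commute (tY d n i) (bbar d n k) := by
  induction k, hk using Nat.le_induction generalizing i with
  | base => exact tY_comm_bY hi hin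
  | succ k hk ih =>
    have hs : 1 ≤ sAct k i ∧ sAct k i ≤ n ∧ sAct k (sAct k i) = i := by
      unfold sAct; split_ifs <;> omega
    have h₁ := tY_mul_gY (d := d) hk hkn hi hin
    have h₂ := tY_mul_gY (d := d) hk hkn hs.1 hs.2.1
    rw [hs.2.2] at h₂
    have h₃ : SemiconjBy (bbar d n k) (tY d n (sAct k i)) (tY d n (sAct k i)) :=
      (ih hs.1 hs.2.1 (by omega)).symm
    rw [bbar_succ hk]
    exact ((show SemiconjBy (gY d n k) _ _ from h₁.symm).mul_left h₃ |>.mul_left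
      (show SemiconjBy (gY d n k) _ _ from h₂.symm)).symm

theorem gY_comm_bbar_of_lt {i k : ℕ} (hk : 1 ≤ k) (hki : k < i) (hin : i < n) :
    Commute (gY d n i) (bbar d n k) := by
  induction k, hk using Nat.le_induction with
  | base => exact (bY_comm_gY hki hin).symm
  | succ k hk ih =>
    have h := (gY_comm_gY (d := d) hk hki hin).symm
    rw [bbar_succ hk]
    exact (h.mul_right (ih (by omega))).mul_right h

theorem gY_comm_bbar {i k : ℕ} (hi : 1 ≤ i) (hik : i + 2 ≤ k) (hkn : k ≤ n) :
    Commute (gY d n i) (bbar d n k) := by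
  induction k, hik using Nat.le_induction with
  | base =>
    have hb := (gY_comm_bbar_of_lt (d := d) hi (Nat.lt_succ_self i) hkn).eq
    have hr := gY_braid (d := d) hi hkn
    rw [bbar_succ (by omega), bbar_succ hi]
    generalize gY d n i = x at *
    generalize gY d n (i + 1) = y at *
    generalize bbar d n i = B at *
    calc x * (y * (x * B * x) * y) = (x * y * x) * B * x * y := by simp only [mul_assoc]
      _ = y * x * (y * B) * x * y := by rw [hr]; simp only [mul_assoc]
      _ = y * x * B * (y * x * y) := by rw [hb]; simp only [mul_assoc]
      _ = y * (x * B * x) * y * x := by rw [← hr]; simp only [mul_assoc]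
  | succ k hk ih =>
    have h := gY_comm_gY (d := d) (n := n) (j := k) hi (by omega) (by omega)
    rw [bbar_succ (by omega)]
    exact (h.mul_right (ih (by omega))).mul_right h

theorem bY_comm_bbar {k : ℕ} (hk : 2 ≤ k) (hkn : k ≤ n) : Commute (bY d n) (bbar d n k) := by
  induction k, hk using Nat.le_induction with
  | base =>
    change bY d n * (gY d n 1 * bY d n * gY d n 1) = gY d n 1 * bY d n * gY d n 1 * bY d n
    rw [← bY_gY_one]
    simp only [mul_assoc]
  | succ k hk ih =>
    have h := bY_comm_gY (d := d) hk hkn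
    rw [bbar_succ (by omega)]
    exact (h.mul_right (ih (by omega))).mul_right h

/-- The generators `b₁, g_1, …, g_{k-1}, t_1, …, t_k` of the subalgebra on the first `k` strands
(none when `k = 0`). -/
def strandGens (d n k : ℕ) : Set (YB d n) :=
  {x | (1 ≤ k ∧ x = bY d n) ∨ (∃ i, 1 ≤ i ∧ i < k ∧ x = gY d n i) ∨
    ∃ j, 1 ≤ j ∧ j ≤ k ∧ x = tY d n j}

/-- The subalgebra on the first `k` strands. -/
def strandAlg (d n k : ℕ) : Subalgebra Kf (YB d n) := Algebra.adjoin Kf (strandGens d n k)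

theorem strandGens_mono {k l : ℕ} (h : k ≤ l) : strandGens d n k ⊆ strandGens d n l := by
  rintro x (⟨hk, rfl⟩ | ⟨i, hi, hik, rfl⟩ | ⟨j, hj, hjk, rfl⟩)
  · exact Or.inl ⟨by omega, rfl⟩
  · exact Or.inr (Or.inl ⟨i, hi, by omega, rfl⟩)
  · exact Or.inr (Or.inr ⟨j, hj, by omega, rfl⟩)

theorem strandAlg_mono {k l : ℕ} (h : k ≤ l) : strandAlg d n k ≤ strandAlg d n l :=
  Algebra.adjoin_mono (strandGens_mono h)

theorem bY_mem {k : ℕ} (hk : 1 ≤ k) : bY d n ∈ strandAlg d n k :=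
  Algebra.subset_adjoin (Or.inl ⟨hk, rfl⟩)

theorem gY_mem {i k : ℕ} (hi : 1 ≤ i) (hik : i < k) : gY d n i ∈ strandAlg d n k :=
  Algebra.subset_adjoin (Or.inr (Or.inl ⟨i, hi, hik, rfl⟩))

theorem tY_mem {j k : ℕ} (hj : 1 ≤ j) (hjk : j ≤ k) : tY d n j ∈ strandAlg d n k :=
  Algebra.subset_adjoin (Or.inr (Or.inr ⟨j, hj, hjk, rfl⟩))

theorem bbar_mem {k : ℕ} (hk : 1 ≤ k) : bbar d n k ∈ strandAlg d n k := by
  induction k, hk using Nat.le_induction with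
  | base => exact bY_mem le_rfl
  | succ k hk ih =>
    rw [bbar_succ hk]
    have h := gY_mem (d := d) (n := n) hk (Nat.lt_succ_self k)
    exact mul_mem (mul_mem h (strandAlg_mono (Nat.le_succ k) ih)) h

theorem Nset_subset_strandAlg (d n k : ℕ) : Nset d n (k + 1) ⊆ strandAlg d n (k + 1) := by
  induction k with
  | zero =>
    rintro x ⟨m, -, rfl | rfl⟩
    · exact pow_mem (tY_mem le_rfl le_rfl) m
    · exact mul_mem (bbar_mem le_rfl) (pow_mem (tY_mem le_rfl le_rfl) m)
  | succ k ih =>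
    rintro x (⟨m, -, rfl | rfl⟩ | ⟨y, hy, rfl⟩)
    · exact pow_mem (tY_mem (by omega) le_rfl) m
    · exact mul_mem (bbar_mem (by omega)) (pow_mem (tY_mem (by omega) le_rfl) m)
    · exact mul_mem (gY_mem (by omega) (by omega)) (strandAlg_mono (Nat.le_succ _) (ih hy))

theorem commute_of_mem_strandAlg {k : ℕ} {c a : YB d n}
    (hc : ∀ s ∈ strandGens d n k, Commute c s) (ha : a ∈ strandAlg d n k) : Commute c a := by
  induction ha using Algebra.adjoin_induction with
  | mem x hx => exact hc x hx
  | algebraMap r => exact (Algebra.commutes r c).symm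
  | add x y _ _ hx hy => exact hx.add_right hy
  | mul x y _ _ hx hy => exact hx.mul_right hy

theorem tY_comm_of_mem {j k : ℕ} (hkj : k < j) (hjn : j ≤ n) {a : YB d n}
    (ha : a ∈ strandAlg d n k) : Commute (tY d n j) a := by
  refine commute_of_mem_strandAlg ?_ ha
  rintro x (⟨hk, rfl⟩ | ⟨i, hi, hik, rfl⟩ | ⟨i, hi, hik, rfl⟩)
  · exact tY_comm_bY (by omega) hjn
  · exact tY_comm_gY hi (by omega) (by omega) hjn (by omega) (by omega)
  · exact tY_comm_tY (by omega) hjn hi (by omega)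

theorem gY_comm_of_mem {j k : ℕ} (hkj : k < j) (hjn : j < n) {a : YB d n}
    (ha : a ∈ strandAlg d n k) : Commute (gY d n j) a := by
  refine commute_of_mem_strandAlg ?_ ha
  rintro x (⟨hk, rfl⟩ | ⟨i, hi, hik, rfl⟩ | ⟨i, hi, hik, rfl⟩)
  · exact (bY_comm_gY (by omega) hjn).symm
  · exact (gY_comm_gY hi (by omega) hjn).symm
  · exact (tY_comm_gY (by omega) hjn hi (by omega) (by omega) (by omega)).symm

theorem bbar_comm_of_mem {j k : ℕ} (hkj : k < j) (hjn : j ≤ n) {a : YB d n}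
    (ha : a ∈ strandAlg d n k) : Commute (bbar d n j) a := by
  refine commute_of_mem_strandAlg ?_ ha
  rintro x (⟨hk, rfl⟩ | ⟨i, hi, hik, rfl⟩ | ⟨i, hi, hik, rfl⟩)
  · exact (bY_comm_bbar (by omega) hjn).symm
  · exact (gY_comm_bbar hi (by omega) hjn).symm
  · exact (tY_comm_bbar hi (by omega) (by omega) hjn).symm

theorem tY_pow_mem_Nset (hd : 1 ≤ d) {k : ℕ} (hk : k + 1 ≤ n) (m : ℕ) :
    tY d n (k + 1) ^ m ∈ Nset d n (k + 1) := by
  have hm : m % d ≤ d - 1 := Nat.le_sub_one_of_lt (Nat.mod_lt m hd)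
  rw [pow_eq_pow_mod m (tY_pow_d (d := d) (Nat.le_add_left 1 k) hk)]
  cases k with
  | zero => exact ⟨_, hm, Or.inl rfl⟩
  | succ k => exact Or.inl ⟨_, hm, Or.inl rfl⟩

theorem bbar_mul_tY_pow_mem_Nset (hd : 1 ≤ d) {k : ℕ} (hk : k + 1 ≤ n) (m : ℕ) :
    bbar d n (k + 1) * tY d n (k + 1) ^ m ∈ Nset d n (k + 1) := by
  have hm : m % d ≤ d - 1 := Nat.le_sub_one_of_lt (Nat.mod_lt m hd)
  rw [pow_eq_pow_mod m (tY_pow_d (d := d) (Nat.le_add_left 1 k) hk)]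
  cases k with
  | zero => exact ⟨_, hm, Or.inr rfl⟩
  | succ k => exact Or.inl ⟨_, hm, Or.inr rfl⟩

/-- The `K`-span of all products `a * x` with `a` supported on the first `k` strands
and `x ∈ N_{d,k+1}`. -/
def cosetSpan (d n k : ℕ) : Submodule Kf (YB d n) :=
  Subalgebra.toSubmodule (strandAlg d n k) * Submodule.span Kf (Nset d n (k + 1))

theorem mul_mem_cosetSpan {k : ℕ} {a x : YB d n} (ha : a ∈ strandAlg d n k)
    (hx : x ∈ Nset d n (k + 1)) : a * x ∈ cosetSpan d n k :=
  Submodule.mul_mem_mul ha (Submodule.subset_span hx)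

theorem mem_cosetSpan {k : ℕ} {x : YB d n} (hx : x ∈ Nset d n (k + 1)) :
    x ∈ cosetSpan d n k := by
  simpa using mul_mem_cosetSpan (one_mem (strandAlg d n k)) hx

theorem mul_mem_of_forall_Nset {k : ℕ} {s : YB d n}
    (h : ∀ x ∈ Nset d n (k + 1), x * s ∈ cosetSpan d n k) {w : YB d n}
    (hw : w ∈ cosetSpan d n k) : w * s ∈ cosetSpan d n k := by
  induction hw using Submodule.mul_induction_on' with
  | mem_mul_mem a ha x hx =>
    rw [mul_assoc]
    have hxs : x * s ∈ cosetSpan d n k := by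
      induction hx using Submodule.span_induction with
      | mem x hx => exact h x hx
      | zero => simp
      | add x y _ _ hx hy => rw [add_mul]; exact add_mem hx hy
      | smul c x _ hx => rw [smul_mul_assoc]; exact Submodule.smul_mem _ c hx
    have := Submodule.mul_mem_mul ha hxs
    rwa [cosetSpan, ← mul_assoc, Subalgebra.isIdempotentElem_toSubmodule] at this
  | add x _ y _ hx hy => rw [add_mul]; exact add_mem hx hy

theorem gY_mul_mem_cosetSpan {k : ℕ} (hk : k + 1 < n) {w : YB d n}
    (hw : w ∈ cosetSpan d n k) : gY d n (k + 1) * w ∈ cosetSpan d n (k + 1) := by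
  induction hw using Submodule.mul_induction_on' with
  | mem_mul_mem a ha x hx =>
    rw [← mul_assoc, (gY_comm_of_mem (Nat.lt_succ_self k) hk ha).eq, mul_assoc]
    refine Submodule.mul_mem_mul (strandAlg_mono (Nat.le_succ k) ha) ?_
    induction hx using Submodule.span_induction with
    | mem x hx => exact Submodule.subset_span (Or.inr ⟨x, hx, rfl⟩)
    | zero => simp
    | add x y _ _ hx hy => rw [mul_add]; exact add_mem hx hy
    | smul c x _ hx => rw [mul_smul_comm]; exact Submodule.smul_mem _ c hx
  | add x _ y _ hx hy => rw [mul_add]; exact add_mem hx hy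

theorem mul_gY_mul_gY_mul_mem {k i : ℕ} (hi : 1 ≤ i) (hin : i < n) {x y : YB d n}
    (h₁ : x * y ∈ cosetSpan d n k)
    (h₂ : ∀ p q : ℕ, x * (tY d n i ^ p * tY d n (i + 1) ^ q * gY d n i) * y ∈ cosetSpan d n k) :
    x * (gY d n i * gY d n i) * y ∈ cosetSpan d n k := by
  rw [gY_mul_self hi hin, mul_add, add_mul, mul_one]
  simp only [smul_mul_assoc, mul_smul_comm, Finset.sum_mul, Finset.mul_sum]
  exact add_mem h₁ (Submodule.smul_mem _ _ (Submodule.smul_mem _ _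
    (Submodule.sum_mem _ fun m _ => h₂ m (d - m))))

theorem Nset_one_mul_mem (hd : 1 ≤ d) (hn : 1 ≤ n) {x s : YB d n} (hx : x ∈ Nset d n 1)
    (hs : s ∈ strandGens d n 1) : x * s ∈ cosetSpan d n 0 := by
  have ht : ∀ m, tY d n 1 ^ m ∈ cosetSpan d n 0 :=
    fun m => mem_cosetSpan (tY_pow_mem_Nset hd hn m)
  have hb : ∀ m, bY d n * tY d n 1 ^ m ∈ cosetSpan d n 0 :=
    fun m => mem_cosetSpan (bbar_mul_tY_pow_mem_Nset hd hn m)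
  have hc : ∀ m, tY d n 1 ^ m * bY d n = bY d n * tY d n 1 ^ m :=
    fun m => ((tY_comm_bY le_rfl hn).pow_left m).eq
  rcases hs with ⟨-, rfl⟩ | ⟨i, hi, hi', -⟩ | ⟨j, hj, hj', rfl⟩
  · obtain ⟨m, -, rfl | rfl⟩ := hx
    · rw [hc]
      exact hb m
    · change bY d n * tY d n 1 ^ m * bY d n ∈ _
      rw [mul_assoc, hc, ← mul_assoc, bY_mul_self, add_mul, one_mul]
      simp only [smul_mul_assoc, Finset.sum_mul]
      refine add_mem (ht m) (Submodule.smul_mem _ _ (Submodule.smul_mem _ _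
        (Submodule.sum_mem _ fun p _ => ?_)))
      rw [hc, mul_assoc, ← pow_add]
      exact hb _
  · omega
  · obtain rfl : j = 1 := by omega
    obtain ⟨m, -, rfl | rfl⟩ := hx
    · rw [← pow_succ]
      exact ht _
    · rw [mul_assoc, ← pow_succ]
      exact hb _

theorem gY_mul_Nset_mul_gY_mem (hd : 1 ≤ d) {k : ℕ} (hk : k + 1 < n) {y : YB d n}
    (hy : y ∈ Nset d n (k + 1)) :
    gY d n (k + 1) * y * gY d n (k + 1) ∈ cosetSpan d n (k + 1) := by
  have hk₁ : 1 ≤ k + 1 := Nat.le_add_left 1 k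
  have ht : tY d n (k + 1) ∈ strandAlg d n (k + 1) := tY_mem hk₁ le_rfl
  have hpow : ∀ m, gY d n (k + 1) * tY d n (k + 1) ^ m * gY d n (k + 1) ∈
      cosetSpan d n (k + 1) := fun m => by
    have key := mul_gY_mul_gY_mul_mem (d := d) (k := k + 1) (x := 1)
      (y := tY d n (k + 1 + 1) ^ m) hk₁ hk
      (by simpa using mem_cosetSpan (tY_pow_mem_Nset hd hk m)) fun p q => by
        rw [one_mul, mul_assoc, ← tY_pow_mul_gY hk₁ hk, mul_assoc, ← mul_assoc (_ ^ q),
          (((tY_comm_tY (d := d) hk₁ hk.le (by omega) hk).pow_pow m q).eq).symm,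
          mul_assoc (_ ^ m), tY_succ_pow_mul_gY hk₁ hk]
        simp only [← mul_assoc]
        rw [mul_assoc]
        exact mul_mem_cosetSpan (mul_mem (pow_mem ht p) (pow_mem ht m))
          (Or.inr ⟨_, tY_pow_mem_Nset hd hk.le q, rfl⟩)
    rwa [one_mul, mul_assoc, ← tY_pow_mul_gY hk₁ hk, ← mul_assoc] at key
  have hbpow : ∀ m, gY d n (k + 1) * (bbar d n (k + 1) * tY d n (k + 1) ^ m) *
      gY d n (k + 1) ∈ cosetSpan d n (k + 1) := fun m => by
    have h := mem_cosetSpan (bbar_mul_tY_pow_mem_Nset (d := d) hd hk m)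
    rw [bbar_succ hk₁, mul_assoc, ← tY_pow_mul_gY hk₁ hk] at h
    simpa only [mul_assoc] using h
  cases k with
  | zero =>
    obtain ⟨m, -, rfl | rfl⟩ := hy
    exacts [hpow m, hbpow m]
  | succ k =>
    obtain ⟨m, -, rfl | rfl⟩ | ⟨z, hz, rfl⟩ := hy
    · exact hpow m
    · exact hbpow m
    · have hzg := gY_comm_of_mem (Nat.lt_succ_self (k + 1)) hk (Nset_subset_strandAlg d n k hz)
      have hbr := gY_braid (d := d) (Nat.le_add_left 1 k) hk
      have : gY d n (k + 1 + 1) * (gY d n (k + 1) * z) * gY d n (k + 1 + 1) =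
          gY d n (k + 1) * (gY d n (k + 1 + 1) * (gY d n (k + 1) * z)) := by
        rw [← mul_assoc, mul_assoc _ z, ← hzg.eq, ← mul_assoc, ← hbr]
        simp only [mul_assoc]
      rw [this]
      exact mul_mem_cosetSpan (gY_mem (by omega) (by omega)) (Or.inr ⟨_, Or.inr ⟨z, hz, rfl⟩, rfl⟩)

theorem bbar_mul_tY_pow_mul_gY_mem (hd : 1 ≤ d) {k : ℕ} (hk : k + 1 < n) (m : ℕ) :
    bbar d n (k + 2) * tY d n (k + 2) ^ m * gY d n (k + 1) ∈ cosetSpan d n (k + 1) := by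
  have hk₁ : 1 ≤ k + 1 := Nat.le_add_left 1 k
  have ht : tY d n (k + 1) ∈ strandAlg d n (k + 1) := tY_mem hk₁ le_rfl
  have key := mul_gY_mul_gY_mul_mem (d := d) (k := k + 1)
    (x := gY d n (k + 1) * bbar d n (k + 1)) (y := tY d n (k + 1) ^ m) hk₁ hk
    (by
      rw [mul_assoc]
      exact mem_cosetSpan (Or.inr ⟨_, bbar_mul_tY_pow_mem_Nset hd hk.le m, rfl⟩))
    fun p q => by
      have hc : Commute (bbar d n (k + 2) * tY d n (k + 2) ^ p) (tY d n (k + 1) ^ (q + m)) :=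
        Commute.mul_left (bbar_comm_of_mem (Nat.lt_succ_self _) hk (pow_mem ht _))
          ((tY_comm_of_mem (Nat.lt_succ_self _) hk (pow_mem ht _)).pow_left p)
      have : gY d n (k + 1) * bbar d n (k + 1) *
          (tY d n (k + 1) ^ p * tY d n (k + 1 + 1) ^ q * gY d n (k + 1)) * tY d n (k + 1) ^ m =
          tY d n (k + 1) ^ (q + m) * (bbar d n (k + 2) * tY d n (k + 2) ^ p) := by
        rw [← hc.eq, mul_assoc (_ ^ p), tY_succ_pow_mul_gY hk₁ hk, ← mul_assoc (_ ^ p),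
          tY_pow_mul_gY hk₁ hk, pow_add, bbar_succ hk₁]
        simp only [mul_assoc]
      rw [this]
      exact mul_mem_cosetSpan (pow_mem ht _) (bbar_mul_tY_pow_mem_Nset hd hk p)
  rw [mul_assoc, tY_succ_pow_mul_gY hk₁ hk, bbar_succ hk₁]
  simpa only [mul_assoc] using key

theorem Nset_mul_mem (hd : 1 ≤ d) {k : ℕ} (hk : k + 1 ≤ n) {x s : YB d n}
    (hx : x ∈ Nset d n (k + 1)) (hs : s ∈ strandGens d n (k + 1)) :
    x * s ∈ cosetSpan d n k := by
  induction k generalizing x s with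
  | zero => exact Nset_one_mul_mem hd hk hx hs
  | succ k ih =>
    have hcases : s ∈ strandGens d n (k + 1) ∨ s = gY d n (k + 1) ∨ s = tY d n (k + 2) := by
      rcases hs with ⟨-, rfl⟩ | ⟨i, hi, hi', rfl⟩ | ⟨j, hj, hj', rfl⟩
      · exact Or.inl (Or.inl ⟨by omega, rfl⟩)
      · rcases Nat.lt_succ_iff_lt_or_eq.1 hi' with h | rfl
        · exact Or.inl (Or.inr (Or.inl ⟨i, hi, h, rfl⟩))
        · exact Or.inr (Or.inl rfl)
      · rcases Nat.le_succ_iff.1 hj' with h | rfl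
        · exact Or.inl (Or.inr (Or.inr ⟨j, hj, h, rfl⟩))
        · exact Or.inr (Or.inr rfl)
    have hcomm : ∀ {a : YB d n}, a ∈ strandAlg d n (k + 1) → Commute (tY d n (k + 2)) a :=
      fun ha => tY_comm_of_mem (Nat.lt_succ_self _) hk ha
    rcases hx with ⟨m, -, rfl | rfl⟩ | ⟨y, hy, rfl⟩
    · rcases hcases with hs | rfl | rfl
      · have hs' := Algebra.subset_adjoin (R := Kf) hs
        rw [((hcomm hs').pow_left m).eq]
        exact mul_mem_cosetSpan hs' (tY_pow_mem_Nset hd hk m)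
      · rw [tY_succ_pow_mul_gY (by omega) hk]
        exact mem_cosetSpan (Or.inr ⟨_, tY_pow_mem_Nset hd (by omega) m, rfl⟩)
      · rw [← pow_succ]
        exact mem_cosetSpan (tY_pow_mem_Nset hd hk _)
    · rcases hcases with hs | rfl | rfl
      · have hs' := Algebra.subset_adjoin (R := Kf) hs
        rw [((bbar_comm_of_mem (Nat.lt_succ_self _) hk hs').mul_left
          ((hcomm hs').pow_left m)).eq]
        exact mul_mem_cosetSpan hs' (bbar_mul_tY_pow_mem_Nset hd hk m)
      · exact bbar_mul_tY_pow_mul_gY_mem hd hk m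
      · rw [mul_assoc, ← pow_succ]
        exact mem_cosetSpan (bbar_mul_tY_pow_mem_Nset hd hk _)
    · rcases hcases with hs | rfl | rfl
      · rw [mul_assoc]
        exact gY_mul_mem_cosetSpan hk (ih (by omega) hy hs)
      · exact gY_mul_Nset_mul_gY_mem hd hk hy
      · have h := tY_pow_mul_gY (d := d) (Nat.le_add_left 1 k) hk 1
        rw [pow_one, pow_one] at h
        rw [mul_assoc, ← (hcomm (Nset_subset_strandAlg d n k hy)).eq, ← mul_assoc, ← h, mul_assoc]
        exact mul_mem_cosetSpan (tY_mem (by omega) le_rfl) (Or.inr ⟨y, hy, rfl⟩)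

theorem strandAlg_succ_le_cosetSpan (hd : 1 ≤ d) {k : ℕ} (hk : k + 1 ≤ n) :
    Subalgebra.toSubmodule (strandAlg d n (k + 1)) ≤ cosetSpan d n k := by
  intro a ha
  have hone : (1 : YB d n) ∈ cosetSpan d n k := by
    simpa using mem_cosetSpan (tY_pow_mem_Nset (d := d) hd hk 0)
  suffices ∀ w ∈ cosetSpan d n k, w * a ∈ cosetSpan d n k by simpa using this 1 hone
  replace ha : a ∈ Algebra.adjoin Kf (strandGens d n (k + 1)) := ha
  induction ha using Algebra.adjoin_induction with
  | mem s hs => exact fun w hw => mul_mem_of_forall_Nset (fun x hx => Nset_mul_mem hd hk hx hs) hw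
  | algebraMap r =>
    intro w hw
    rw [← Algebra.commutes, ← Algebra.smul_def]
    exact Submodule.smul_mem _ r hw
  | add x y _ _ hx hy =>
    intro w hw
    rw [mul_add]
    exact add_mem (hx w hw) (hy w hw)
  | mul x y _ _ hx hy =>
    intro w hw
    rw [← mul_assoc]
    exact hy _ (hx w hw)

/-- The products `𝔫_1 ⋯ 𝔫_k` with `𝔫_i ∈ N_{d,i}`, inside `Y_{d,n}^B`. -/
def partialDset (d n k : ℕ) : Set (YB d n) :=
  {x | ∃ f : Fin k → YB d n, (∀ i : Fin k, f i ∈ Nset d n (i.val + 1)) ∧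
    x = (List.ofFn f).prod}

theorem mul_mem_partialDset {k : ℕ} {x y : YB d n} (hx : x ∈ partialDset d n k)
    (hy : y ∈ Nset d n (k + 1)) : x * y ∈ partialDset d n (k + 1) := by
  obtain ⟨f, hf, rfl⟩ := hx
  refine ⟨Fin.snoc (α := fun _ => YB d n) f y, fun i => ?_, ?_⟩
  · cases i using Fin.lastCases with
    | last => simpa using hy
    | cast i => simpa using hf i
  · rw [List.ofFn_succ', List.concat_eq_append, List.prod_append]
    simp

theorem strandAlg_le_span_partialDset (hd : 1 ≤ d) {k : ℕ} (hk : k ≤ n) :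
    Subalgebra.toSubmodule (strandAlg d n k) ≤ Submodule.span Kf (partialDset d n k) := by
  induction k with
  | zero =>
    have hgens : strandGens d n 0 = ∅ := by
      rw [Set.eq_empty_iff_forall_notMem]
      rintro x (⟨h, -⟩ | ⟨i, h, h', -⟩ | ⟨j, h, h', -⟩) <;> omega
    rw [strandAlg, hgens, Algebra.adjoin_empty, Algebra.toSubmodule_bot, Submodule.one_le]
    exact Submodule.subset_span ⟨Fin.elim0, fun i => i.elim0, by simp⟩
  | succ k ih =>
    refine (strandAlg_succ_le_cosetSpan hd hk).trans
      ((mul_le_mul_left (ih (by omega)) _).trans ?_)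
    rw [Submodule.span_mul_span, Submodule.span_le]
    rintro _ ⟨x, hx, y, hy, rfl⟩
    exact Submodule.subset_span (mul_mem_partialDset hx hy)

theorem mkY_surjective (d n : ℕ) : Function.Surjective (mkY d n) :=
  RingQuot.mkAlgHom_surjective Kf (YBrel d n)

theorem strandAlg_self (hn : 1 ≤ n) : strandAlg d n n = ⊤ := by
  rw [eq_top_iff]
  rintro x -
  obtain ⟨a, rfl⟩ := mkY_surjective d n x
  induction a using FreeAlgebra.induction with
  | grade0 r => rw [AlgHom.commutes]; exact Subalgebra.algebraMap_mem _ r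
  | grade1 s =>
    cases s with
    | b => exact bY_mem hn
    | g i =>
      have hi := i.isLt
      have h := gY_mem (d := d) (n := n) (i := i + 1) (k := n) (by omega) (by omega)
      rwa [gY, Gg, dif_pos (by omega)] at h
    | t j =>
      have h := tY_mem (d := d) (n := n) (j := j + 1) (k := n) (by omega) (by omega)
      rwa [tY, Tt, dif_pos (by omega)] at h
  | mul a b ha hb => rw [map_mul]; exact mul_mem ha hb
  | add a b ha hb => rw [map_add]; exact add_mem ha hb

end YB

/-- the set `𝖣_n` spans `Y_{d,n}^B` over `K`. -/
theorem stmt7 (d n : ℕ) (hd : 1 ≤ d) (hn : 2 ≤ n) :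
    ∀ x : YB d n, x ∈ Submodule.span Kf (Dset d n) := by
  intro x
  refine YB.strandAlg_le_span_partialDset hd le_rfl ?_
  rw [YB.strandAlg_self (by omega)]
  trivial
end
end
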